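/- Fix k ≥ 2. There exist real constants c₁, c₂ > 0 and N ∈ ℕ such that for all n ≥ N, the number of isomorphism classes of minimally unsatisfiable 2-clause-sets F of deficiency k with exactly n variables satisfies c₁ · n^{3k−1} ≤ (number of classes) ≤ c₂ · n^{3k−1}. -/

import Mathlib

/-- A literal: a variable (a natural number) together with a polarity. -/
abbrev Lit : Type := ℕ × Bool

/-- Complementation of literals: a fixed-point-free involution. -/
def Lit.compl (x : Lit) : Lit := (x.1, !x.2)

/-- The set of variables occurring in a clause-set. -/
def varsOf (F : Finset (Finset Lit)) : Finset ℕ := F.biUnion (fun C => C.image Prod.fst)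

/-- The literals over the variables of `F` (both polarities). -/
def litsOf (F : Finset (Finset Lit)) : Finset Lit := varsOf F ×ˢ (Finset.univ : Finset Bool)

/-- A clause is clash-free. -/
def IsClause (C : Finset Lit) : Prop := ∀ x ∈ C, Lit.compl x ∉ C

/-- A clause-set consists of clauses. -/
def IsClauseSet (F : Finset (Finset Lit)) : Prop := ∀ C ∈ F, IsClause C

/-- The truth value of a literal under a total assignment. -/
def LitVal (φ : ℕ → Bool) (x : Lit) : Bool := if x.2 then φ x.1 else !(φ x.1)

/-- Satisfiability of a clause-set. -/
def Sat (F : Finset (Finset Lit)) : Prop := ∃ φ : ℕ → Bool, ∀ C ∈ F, ∃ x ∈ C, LitVal φ x = true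

/-- Minimal unsatisfiability. -/
def MU (F : Finset (Finset Lit)) : Prop := IsClauseSet F ∧ ¬ Sat F ∧ ∀ G ⊂ F, Sat G

/-- Minimally unsatisfiable 2-clause-set. -/
def MU2 (F : Finset (Finset Lit)) : Prop := MU F ∧ ∀ C ∈ F, C.card ≤ 2

/-- The deficiency δ(F) = c(F) - n(F). -/
def deficiency (F : Finset (Finset Lit)) : ℤ := (F.card : ℤ) - ((varsOf F).card : ℤ)

/-- Literal-degree: number of clauses containing the literal. -/
def ldeg (F : Finset (Finset Lit)) (x : Lit) : ℕ := (F.filter (fun C => x ∈ C)).card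

/-- Variable-degree. -/
def vdeg (F : Finset (Finset Lit)) (v : ℕ) : ℕ := ldeg F (v, true) + ldeg F (v, false)

/-- Isomorphism of clause-sets: a bijection between the literals over the variables,
commuting with complementation, mapping one clause-set onto the other. -/
def CNFIso (F F' : Finset (Finset Lit)) (f : Lit → Lit) : Prop :=
  Set.BijOn f ↑(litsOf F) ↑(litsOf F') ∧
  (∀ x ∈ litsOf F, f (Lit.compl x) = Lit.compl (f x)) ∧
  F.image (fun C => C.image f) = F'

/-- A digraph: a finite vertex set and a finite set of arcs. -/
structure FinDigraph (α : Type) where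
  V : Finset α
  E : Finset (α × α)

/-- Well-formedness of a digraph: arcs join distinct vertices. -/
def FinDigraph.WellFormed {α : Type} (G : FinDigraph α) : Prop :=
  ∀ p ∈ G.E, p.1 ∈ G.V ∧ p.2 ∈ G.V ∧ p.1 ≠ p.2

/-- `f` is an isomorphism of digraphs from `G` to `G'`. -/
def DigraphIso {α β : Type} [DecidableEq β] (G : FinDigraph α) (G' : FinDigraph β) (f : α → β) : Prop :=
  Set.BijOn f ↑G.V ↑G'.V ∧ G.E.image (fun p => (f p.1, f p.2)) = G'.E

/-- The implication digraph of a 2-clause-set (without the empty clause):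
vertices are the literals over the variables of `F`, and there is an arc `(a,b)` iff
`{compl a} ∪ {b}` is a clause of `F` (this yields `(x̄,y),(ȳ,x)` for a clause `{x,y}`
and `(x̄,x)` for a unit-clause `{x}`). -/
def idg (F : Finset (Finset Lit)) : FinDigraph Lit :=
  ⟨litsOf F, (litsOf F ×ˢ litsOf F).filter (fun p => insert (Lit.compl p.1) {p.2} ∈ F)⟩

def FinDigraph.inDeg {α : Type} [DecidableEq α] (G : FinDigraph α) (v : α) : ℕ :=
  (G.E.filter (fun p => p.2 = v)).card

def FinDigraph.outDeg {α : Type} [DecidableEq α] (G : FinDigraph α) (v : α) : ℕ :=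
  (G.E.filter (fun p => p.1 = v)).card

/-- The standard double `m`-cycle. -/
def stdDoubleCycle (m : ℕ) : FinDigraph ℕ :=
  ⟨Finset.range m, (Finset.range m).biUnion (fun i => {(i, (i+1) % m), ((i+1) % m, i)})⟩

/-- A double `m`-cycle (`m ≥ 3`). -/
def IsDoubleCycle {α : Type} [DecidableEq α] (m : ℕ) (G : FinDigraph α) : Prop :=
  3 ≤ m ∧ ∃ f : ℕ → α, DigraphIso (stdDoubleCycle m) G f

/-- Splitting a vertex `x` into `u`, `v` with a new arc `(u,v)`:
arcs into `x` now go into `u`, arcs out of `x` now leave `v`. -/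
def SplitVertex {α : Type} [DecidableEq α] (G G' : FinDigraph α) : Prop :=
  ∃ x u v, x ∈ G.V ∧ u ∉ G.V ∧ v ∉ G.V ∧ u ≠ v ∧
    G'.V = insert u (insert v (G.V.erase x)) ∧
    G'.E = insert (u, v)
      ((G.E.filter (fun p => p.1 ≠ x ∧ p.2 ≠ x)) ∪
       ((G.E.filter (fun p => p.2 = x)).image (fun p => (p.1, u))) ∪
       ((G.E.filter (fun p => p.1 = x)).image (fun p => (v, p.2))))

/-- Splitting an arc `(x,y)` by a new (linear) vertex `v`. -/
def SplitArc {α : Type} [DecidableEq α] (G G' : FinDigraph α) : Prop :=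
  ∃ x y v, (x, y) ∈ G.E ∧ v ∉ G.V ∧
    G'.V = insert v G.V ∧
    G'.E = insert (x, v) (insert (v, y) (G.E.erase (x, y)))

/-- An `m`-weak-double-cycle: obtained from a double `m`-cycle by a finite sequence
of vertex splittings and arc splittings. -/
def IsWDC {α : Type} [DecidableEq α] (m : ℕ) (G : FinDigraph α) : Prop :=
  ∃ G₀ : FinDigraph α, IsDoubleCycle m G₀ ∧
    Relation.ReflTransGen (fun A B => SplitVertex A B ∨ SplitArc A B) G₀ G

/-- A digraph is nonlinear if no vertex has in-degree 1 and out-degree 1. -/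
def FinDigraph.Nonlinear {α : Type} [DecidableEq α] (G : FinDigraph α) : Prop :=
  ∀ v ∈ G.V, ¬ (G.inDeg v = 1 ∧ G.outDeg v = 1)

/-- Strong connectivity. -/
def StronglyConnected {α : Type} (G : FinDigraph α) : Prop :=
  ∀ a ∈ G.V, ∀ b ∈ G.V, Relation.ReflTransGen (fun x y => (x, y) ∈ G.E) a b

/-- A cycle digraph: strongly connected, at least 2 vertices, all vertices linear. -/
def IsCycleDigraph {α : Type} [DecidableEq α] (G : FinDigraph α) : Prop :=
  G.WellFormed ∧ 2 ≤ G.V.card ∧ StronglyConnected G ∧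
    ∀ v ∈ G.V, G.inDeg v = 1 ∧ G.outDeg v = 1

/-- A skew-symmetry of a digraph, as a permutation of its vertex set:
a fixed-point-free involution reversing arcs. -/
def IsSkewSym {α : Type} (G : FinDigraph α) (σ : Equiv.Perm {x // x ∈ G.V}) : Prop :=
  (∀ v, σ (σ v) = v) ∧ (∀ v, σ v ≠ v) ∧
  ∀ a b : {x // x ∈ G.V}, ((a : α), (b : α)) ∈ G.E → (((σ b : α)), ((σ a : α))) ∈ G.E

/-- A skew-symmetry has a unit if some vertex is joined by an arc to its image. -/
def HasUnit {α : Type} (G : FinDigraph α) (σ : Equiv.Perm {x // x ∈ G.V}) : Prop :=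
  ∃ v : {x // x ∈ G.V}, ((v : α), ((σ v : α))) ∈ G.E

/-- The literals over the variables of `F` are closed under complementation. -/
lemma compl_mem {F : Finset (Finset Lit)} {x : Lit} (h : x ∈ litsOf F) :
    Lit.compl x ∈ litsOf F := by
  simp only [litsOf, Lit.compl, Finset.mem_product] at h ⊢
  exact ⟨h.1, Finset.mem_univ _⟩

/-- Clause-set isomorphism, as an equivalence between the literals over the variables. -/
def CNFIsoE (F F' : Finset (Finset Lit))
    (e : {x // x ∈ litsOf F} ≃ {x // x ∈ litsOf F'}) : Prop :=
  (∀ x : {x // x ∈ litsOf F}, (e ⟨Lit.compl x.1, compl_mem x.2⟩ : Lit) = Lit.compl (e x : Lit)) ∧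
  F.image (fun C => C.image (fun y =>
      if h : y ∈ litsOf F then ((e ⟨y, h⟩ : {x // x ∈ litsOf F'}) : Lit) else y)) = F'

/-- An automorphism of a digraph, as a permutation of its vertex set preserving arcs. -/
def FinDigraphAut {α : Type} (G : FinDigraph α) (π : Equiv.Perm {x // x ∈ G.V}) : Prop :=
  ∀ a b : {x // x ∈ G.V}, ((a : α), (b : α)) ∈ G.E ↔ ((π a : α), (π b : α)) ∈ G.E

/-- Multiplicity of the edge between `u` and `v` in the underlying multigraph of a digraph. -/
def mult {α : Type} [DecidableEq α] (G : FinDigraph α) (u v : α) : ℕ :=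
  (if (u, v) ∈ G.E then 1 else 0) + (if (v, u) ∈ G.E then 1 else 0)

/-- `f` is an isomorphism between the underlying multigraphs of two digraphs. -/
def MultigraphIso {α β : Type} [DecidableEq α] [DecidableEq β]
    (G : FinDigraph α) (G' : FinDigraph β) (f : α → β) : Prop :=
  Set.BijOn f ↑G.V ↑G'.V ∧ ∀ u ∈ G.V, ∀ v ∈ G.V, mult G u v = mult G' (f u) (f v)

/-- `f` is an isomorphism between the underlying graphs of two digraphs. -/
def GraphIso {α β : Type} (G : FinDigraph α) (G' : FinDigraph β) (f : α → β) : Prop :=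
  Set.BijOn f ↑G.V ↑G'.V ∧ ∀ u ∈ G.V, ∀ v ∈ G.V,
    (((u, v) ∈ G.E ∨ (v, u) ∈ G.E) ↔ ((f u, f v) ∈ G'.E ∨ (f v, f u) ∈ G'.E))

/-- The transpose of a digraph: all arcs reversed. -/
def FinDigraph.transpose {α : Type} [DecidableEq α] (G : FinDigraph α) : FinDigraph α :=
  ⟨G.V, G.E.image (fun p => (p.2, p.1))⟩

/-- DP-reduction on variable `v`: replace all clauses containing `v` or `v̄` by all
their non-tautological resolvents on `v`. -/
def DP (v : ℕ) (F : Finset (Finset Lit)) : Finset (Finset Lit) :=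
  (F.filter (fun C => (v, true) ∉ C ∧ (v, false) ∉ C)) ∪
  ((((F.filter (fun C => (v, true) ∈ C)) ×ˢ (F.filter (fun C => (v, false) ∈ C))).image
      (fun p => (p.1.erase (v, true)) ∪ (p.2.erase (v, false)))).filter
    (fun C => ∀ x ∈ C, Lit.compl x ∉ C))

/-- A variable is singular if one of its literals has literal-degree 1. -/
def Singular (F : Finset (Finset Lit)) (v : ℕ) : Prop :=
  ldeg F (v, true) = 1 ∨ ldeg F (v, false) = 1

/-- The "middle part" `M_n = {{v̄_1,v_2},…,{v̄_{n−1},v_n}}`, with variables `1,…,n`. -/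
def Mn (n : ℕ) : Finset (Finset Lit) :=
  (Finset.Icc 1 (n - 1)).image (fun i => ({(i, false), (i + 1, true)} : Finset Lit))

def famU2 (n : ℕ) : Finset (Finset Lit) :=
  Mn n ∪ {({((1 : ℕ), true)} : Finset Lit), ({((n : ℕ), false)} : Finset Lit)}

def famU1 (n i : ℕ) : Finset (Finset Lit) :=
  Mn n ∪ {({((1 : ℕ), true)} : Finset Lit), ({((n : ℕ), false), ((i : ℕ), false)} : Finset Lit)}

def famU0s (n i : ℕ) : Finset (Finset Lit) :=
  Mn n ∪ {({((1 : ℕ), true), ((i : ℕ), true)} : Finset Lit),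
          ({((n : ℕ), false), ((i : ℕ), false)} : Finset Lit)}

def famU0 (n x y : ℕ) : Finset (Finset Lit) :=
  Mn n ∪ {({((1 : ℕ), true), ((x : ℕ), true)} : Finset Lit),
          ({((n : ℕ), false), ((y : ℕ), false)} : Finset Lit)}

/-- Membership in one of the four families (with the stated parameter ranges). -/
def InFam (G : Finset (Finset Lit)) : Prop :=
  (∃ n, 1 ≤ n ∧ G = famU2 n) ∨
  (∃ n i, 2 ≤ n ∧ 1 ≤ i ∧ i ≤ n - 1 ∧ G = famU1 n i) ∨
  (∃ n i, 3 ≤ n ∧ 2 ≤ i ∧ 2 * i ≤ n + 1 ∧ G = famU0s n i) ∨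
  (∃ n x y, 4 ≤ n ∧ 2 ≤ x ∧ x < y ∧ y ≤ n - 1 ∧ x + y ≤ n + 1 ∧ G = famU0 n x y)

/-- The number of unit-clauses of `F`. -/
def unitCount (F : Finset (Finset Lit)) : ℕ := (F.filter (fun C => C.card = 1)).card

/-- MU 2-clause-sets of deficiency `k` with exactly `n` variables. -/
def MU2dn (k : ℤ) (n : ℕ) : Type :=
  {F : Finset (Finset Lit) // MU2 F ∧ deficiency F = k ∧ (varsOf F).card = n}

/-- Isomorphism relation on `MU2dn k n`. -/
def isoRel {k : ℤ} {n : ℕ} (F F' : MU2dn k n) : Prop := ∃ f, CNFIso F.1 F'.1 f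

/-- The number of isomorphism classes of MU 2-clause-sets of deficiency `k`
with exactly `n` variables. -/
noncomputable def numClasses (k : ℤ) (n : ℕ) : ℕ := Nat.card (Quot (@isoRel k n))

/-- Equivalence of binary bracelets of length `m`: rotations and reflections of the
cyclic index set. -/
def BraceletRel (m : ℕ) (b b' : ZMod m → Bool) : Prop :=
  ∃ (r : ZMod m) (s : Bool), ∀ i, b' i = b (if s then r - i else i + r)

/-- Digraph-isomorphism relation on nonlinear `m`-WDCs. -/
def NonlinWDCRel (m : ℕ) (G G' : {G : FinDigraph ℕ // IsWDC m G ∧ G.Nonlinear}) : Prop :=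
  ∃ f : ℕ → ℕ, DigraphIso G.1 G'.1 f

/-- `H` is a subdigraph of `G`. -/
def Subdigraph {α : Type} (H G : FinDigraph α) : Prop := H.V ⊆ G.V ∧ H.E ⊆ G.E

section Literals

@[simp] lemma Lit.compl_compl (x : Lit) : x.compl.compl = x := by simp [Lit.compl]

@[simp] lemma Lit.compl_fst (x : Lit) : x.compl.1 = x.1 := rfl

lemma Lit.compl_ne (x : Lit) : x.compl ≠ x := by
  rcases x with ⟨v, b⟩
  cases b <;> simp [Lit.compl]

lemma Lit.compl_injective : Function.Injective Lit.compl :=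
  Function.LeftInverse.injective Lit.compl_compl

@[simp] lemma Lit.compl_inj {x y : Lit} : x.compl = y.compl ↔ x = y :=
  Lit.compl_injective.eq_iff

lemma Lit.eq_or_eq_compl {x y : Lit} (h : x.1 = y.1) : x = y ∨ x = y.compl := by
  rcases x with ⟨v, b⟩
  rcases y with ⟨w, c⟩
  obtain rfl : v = w := h
  cases b <;> cases c <;> simp [Lit.compl]

@[simp] lemma litVal_compl (φ : ℕ → Bool) (x : Lit) : LitVal φ x.compl = !LitVal φ x := by
  rcases x with ⟨v, b⟩
  cases b <;> simp [LitVal, Lit.compl]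

lemma litVal_congr {φ ψ : ℕ → Bool} {x : Lit} (h : φ x.1 = ψ x.1) :
    LitVal φ x = LitVal ψ x := by
  simp [LitVal, h]

lemma mem_varsOf {F : Finset (Finset Lit)} {v : ℕ} :
    v ∈ varsOf F ↔ ∃ C ∈ F, ∃ x ∈ C, x.1 = v := by
  simp [varsOf]

lemma mem_litsOf {F : Finset (Finset Lit)} {x : Lit} : x ∈ litsOf F ↔ x.1 ∈ varsOf F := by
  simp [litsOf]

lemma mem_litsOf_of_mem {F : Finset (Finset Lit)} {C : Finset Lit} {x : Lit}
    (hC : C ∈ F) (hx : x ∈ C) : x ∈ litsOf F :=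
  mem_litsOf.2 (mem_varsOf.2 ⟨C, hC, x, hx, rfl⟩)

end Literals

section Isomorphism

/-- Relabellings of two clause-sets with the same image induce an isomorphism. -/
lemma exists_cnfIso_of_image_eq {F F' : Finset (Finset Lit)} {g g' : Lit → Lit}
    (hg : Set.InjOn g ↑(litsOf F)) (hg' : Set.InjOn g' ↑(litsOf F'))
    (hc : ∀ x ∈ litsOf F, g x.compl = (g x).compl)
    (hc' : ∀ x ∈ litsOf F', g' x.compl = (g' x).compl)
    (h : F.image (fun C => C.image g) = F'.image (fun C => C.image g')) :
    ∃ f, CNFIso F F' f := by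
  have key : ∀ {A B : Finset (Finset Lit)} {a b : Lit → Lit}
      (_ : A.image (fun C => C.image a) = B.image (fun C => C.image b))
      (_ : ∀ x ∈ litsOf A, a x.compl = (a x).compl) (_ : ∀ x ∈ litsOf B, b x.compl = (b x).compl)
      (x) (_ : x ∈ litsOf A), ∃ y ∈ litsOf B, b y = a x := by
    intro A B a b hAB ha hb x hx
    obtain ⟨C, hC, y, hy, hyx⟩ := mem_varsOf.1 (mem_litsOf.1 hx)
    have : C.image a ∈ B.image (fun C => C.image b) :=
      hAB ▸ Finset.mem_image_of_mem (fun C => C.image a) hC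
    obtain ⟨D, hD, hDC⟩ := Finset.mem_image.1 this
    have : a y ∈ D.image b := hDC ▸ Finset.mem_image_of_mem a hy
    obtain ⟨z, hz, hzy⟩ := Finset.mem_image.1 this
    have hzB := mem_litsOf_of_mem hD hz
    rcases Lit.eq_or_eq_compl hyx with rfl | rfl
    · exact ⟨z, hzB, hzy⟩
    · refine ⟨z.compl, compl_mem hzB, ?_⟩
      rw [hb z hzB, hzy, ha x hx, Lit.compl_compl]
  choose! f hfm hf using key h hc hc'
  refine ⟨f, ⟨fun x hx => hfm x hx, ?_, ?_⟩, ?_, ?_⟩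
  · intro x hx y hy hxy
    apply hg hx hy
    rw [← hf x hx, ← hf y hy, hxy]
  · intro y hy
    obtain ⟨x, hx, hxy⟩ := key h.symm hc' hc y hy
    exact ⟨x, hx, hg' (hfm x hx) hy ((hf x hx).trans hxy)⟩
  · intro x hx
    apply hg' (hfm _ (compl_mem hx)) (compl_mem (hfm x hx))
    rw [hf _ (compl_mem hx), hc x hx, hc' _ (hfm x hx), hf x hx]
  · have himg : ∀ C ∈ F, (C.image f).image g' = C.image g := by
      intro C hC
      rw [Finset.image_image]
      exact Finset.image_congr fun x hx => hf x (mem_litsOf_of_mem hC hx)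
    have hinj : ∀ C ∈ F, ∀ D ∈ F', C.image g = D.image g' → C.image f = D := by
      intro C hC D hD hCD
      rw [← himg C hC] at hCD
      apply Finset.coe_injective
      refine (hg'.image_eq_image_iff ?_ ?_).1 (by exact_mod_cast hCD)
      · intro y hy
        obtain ⟨x, hx, rfl⟩ := Finset.mem_image.1 (Finset.mem_coe.1 hy)
        exact hfm x (mem_litsOf_of_mem hC hx)
      · exact fun y hy => mem_litsOf_of_mem hD hy
    ext D
    constructor
    · intro hD
      obtain ⟨C, hC, rfl⟩ := Finset.mem_image.1 hD
      have : C.image g ∈ F'.image (fun C => C.image g') :=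
        h ▸ Finset.mem_image_of_mem (fun C => C.image g) hC
      obtain ⟨D, hD, hDC⟩ := Finset.mem_image.1 this
      rwa [hinj C hC D hD hDC.symm]
    · intro hD
      have : D.image g' ∈ F.image (fun C => C.image g) :=
        h ▸ Finset.mem_image_of_mem (fun C => C.image g') hD
      obtain ⟨C, hC, hCD⟩ := Finset.mem_image.1 this
      exact Finset.mem_image.2 ⟨C, hC, hinj C hC D hD hCD⟩

lemma CNFIso.exists_symm {F F' : Finset (Finset Lit)} {f : Lit → Lit} (h : CNFIso F F' f) :
    ∃ g, CNFIso F' F g := by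
  refine exists_cnfIso_of_image_eq (g := id) (g' := f) Function.injective_id.injOn h.1.injOn
    (fun _ _ => rfl) h.2.1 ?_
  simp [h.2.2]

end Isomorphism

section MinimalUnsatisfiability

lemma Sat.mono {F G : Finset (Finset Lit)} (h : G ⊆ F) : Sat F → Sat G :=
  fun ⟨φ, hφ⟩ => ⟨φ, fun C hC => hφ C (h hC)⟩

/-- A minimally unsatisfiable clause-set has no nontrivial autarky. -/
lemma MU.not_touches_of_autarky {F : Finset (Finset Lit)} (hF : MU F) (V : Set ℕ) (φ : ℕ → Bool)
    (hφ : ∀ C ∈ F, (∃ x ∈ C, x.1 ∈ V) → ∃ x ∈ C, x.1 ∈ V ∧ LitVal φ x = true) :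
    ∀ C ∈ F, ∀ x ∈ C, x.1 ∉ V := by
  classical
  intro C₀ hC₀ x₀ hx₀ hV
  have hss : F.filter (fun C => ∀ x ∈ C, x.1 ∉ V) ⊂ F := by
    refine Finset.filter_ssubset.2 ⟨C₀, hC₀, fun h => h x₀ hx₀ hV⟩
  obtain ⟨ψ, hψ⟩ := hF.2.2 _ hss
  refine hF.2.1 ⟨fun v => if v ∈ V then φ v else ψ v, fun C hC => ?_⟩
  by_cases h : ∃ x ∈ C, x.1 ∈ V
  · obtain ⟨x, hx, hxV, hxφ⟩ := hφ C hC h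
    exact ⟨x, hx, by rw [← hxφ]; exact litVal_congr (if_pos hxV)⟩
  · push Not at h
    obtain ⟨x, hx, hxψ⟩ := hψ C (Finset.mem_filter.2 ⟨hC, h⟩)
    exact ⟨x, hx, by rw [← hxψ]; exact litVal_congr (if_neg (h x hx))⟩

lemma MU.exists_mem_of_mem_litsOf {F : Finset (Finset Lit)} (hF : MU F) {x : Lit}
    (hx : x ∈ litsOf F) : ∃ C ∈ F, x ∈ C := by
  by_contra! h
  obtain ⟨C, hC, y, hy, hyx⟩ := mem_varsOf.1 (mem_litsOf.1 hx)
  refine hF.not_touches_of_autarky {x.1} (fun _ => !x.2) ?_ C hC y hy hyx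
  rintro D hD ⟨z, hz, hzx : z.1 = x.1⟩
  refine ⟨z, hz, hzx, ?_⟩
  rcases Lit.eq_or_eq_compl hzx with rfl | rfl
  · exact absurd hz (h D hD)
  · rcases x with ⟨v, b⟩
    cases b <;> simp [LitVal, Lit.compl]

end MinimalUnsatisfiability

section ChainClauses

/-- The implications between consecutive literals of a list, as 2-clauses. -/
def chainClauses : List Lit → Finset (Finset Lit)
  | [] => ∅
  | [_] => ∅
  | a :: b :: l => insert {a.compl, b} (chainClauses (b :: l))

lemma chainClauses_append (l : List Lit) (x : Lit) (r : List Lit) :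
    chainClauses (l ++ x :: r) = chainClauses (l ++ [x]) ∪ chainClauses (x :: r) := by
  induction l with
  | nil => simp [chainClauses]
  | cons a l ih =>
    cases l with
    | nil => cases r <;> simp [chainClauses, Finset.insert_comm]
    | cons b l =>
      simp only [List.cons_append, chainClauses] at ih ⊢
      rw [ih, Finset.insert_union]

lemma chainClauses_reverse (l : List Lit) :
    chainClauses (l.reverse.map Lit.compl) = chainClauses l := by
  induction l with
  | nil => rfl
  | cons a l ih =>
    cases l with
    | nil => rfl
    | cons b l =>
      have h : ((a :: b :: l).reverse.map Lit.compl) =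
          (l.reverse.map Lit.compl) ++ b.compl :: [a.compl] := by simp
      have h' : ((b :: l).reverse.map Lit.compl) = (l.reverse.map Lit.compl) ++ [b.compl] := by simp
      rw [h, chainClauses_append, ← h', ih]
      simp only [chainClauses, Lit.compl_compl, insert_empty_eq]
      rw [Finset.union_comm, Finset.pair_comm]
      rfl

lemma chainClauses_map (g : Lit → Lit) (hg : ∀ x, g x.compl = (g x).compl) (l : List Lit) :
    chainClauses (l.map g) = (chainClauses l).image (fun C => C.image g) := by
  induction l with
  | nil => rfl
  | cons a l ih =>
    cases l with
    | nil => rfl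
    | cons b l =>
      simp only [List.map_cons, chainClauses, Finset.image_insert, Finset.image_singleton, hg] at ih ⊢
      rw [ih]

lemma exists_mem_chainClauses {l : List Lit} (hl : 2 ≤ l.length) {y : Lit} (hy : y ∈ l) :
    ∃ C ∈ chainClauses l, ∃ z ∈ C, z.1 = y.1 := by
  induction l with
  | nil => simp at hy
  | cons a l ih =>
    cases l with
    | nil => simp at hl
    | cons b l =>
      rcases List.mem_cons.1 hy with rfl | hy
      · exact ⟨_, Finset.mem_insert_self _ _, y.compl, by simp, rfl⟩
      · by_cases hyb : y = b
        · exact ⟨_, Finset.mem_insert_self _ _, y, by simp [hyb], rfl⟩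
        · have hyl : y ∈ l := by simpa [hyb] using hy
          have : 2 ≤ (b :: l).length := by
            have := List.length_pos_of_mem hyl
            simp only [List.length_cons]; omega
          obtain ⟨C, hC, h⟩ := ih this hy
          exact ⟨C, Finset.mem_insert_of_mem hC, h⟩

lemma eq_or_of_mem_chainClauses {s t : Lit} {m : List Lit} {C : Finset Lit}
    (hC : C ∈ chainClauses (s :: (m ++ [t]))) {y : Lit} (hy : y ∈ C) :
    y = s.compl ∨ y = t ∨ y.1 ∈ m.map Prod.fst := by
  induction m generalizing s with
  | nil =>
    simp only [List.nil_append, chainClauses, insert_empty_eq, Finset.mem_singleton] at hC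
    subst hC
    simp only [Finset.mem_insert, Finset.mem_singleton] at hy
    tauto
  | cons a m ih =>
    rcases Finset.mem_insert.1 hC with rfl | hC
    · rcases Finset.mem_insert.1 hy with rfl | hy
      · simp
      · rw [Finset.mem_singleton.1 hy]; simp
    · rcases ih hC with rfl | h | h
      · simp
      · exact Or.inr (Or.inl h)
      · exact Or.inr (Or.inr (List.mem_cons_of_mem _ h))

lemma exists_mem_tail_of_mem_chainClauses {s : Lit} {m : List Lit} {C : Finset Lit}
    (hC : C ∈ chainClauses (s :: m)) : ∃ y ∈ m, y ∈ C := by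
  induction m generalizing s with
  | nil => simp [chainClauses] at hC
  | cons a m ih =>
    rcases Finset.mem_insert.1 hC with rfl | hC
    · exact ⟨a, by simp, by simp⟩
    · obtain ⟨y, hy, hyC⟩ := ih hC
      exact ⟨y, List.mem_cons_of_mem _ hy, hyC⟩

end ChainClauses

section Threads

/-- A thread: a chain of literals `src, mid…, tgt` with distinguished interior. -/
structure Thread where
  src : Lit
  mid : List Lit
  tgt : Lit

namespace Thread

def lits (θ : Thread) : List Lit := θ.src :: (θ.mid ++ [θ.tgt])

def flip (θ : Thread) : Thread := ⟨θ.tgt.compl, θ.mid.reverse.map Lit.compl, θ.src.compl⟩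

lemma chainClauses_flip (θ : Thread) : chainClauses θ.flip.lits = chainClauses θ.lits := by
  rw [← chainClauses_reverse θ.lits]
  simp [flip, lits]

lemma map_fst_mid_flip (θ : Thread) :
    θ.flip.mid.map Prod.fst = (θ.mid.map Prod.fst).reverse := by
  simp [flip, Function.comp_def]

/-- The occurrences of literals in clauses contributed by the ends of a thread. -/
def ends (θ : Thread) : List Lit := [θ.src.compl, θ.tgt]

lemma ends_flip (θ : Thread) : θ.flip.ends.Perm θ.ends := by
  simpa [ends, flip] using List.Perm.swap _ _ _

end Thread

def innerLits (T : List Thread) : List Lit := T.flatMap Thread.mid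

def endOccs (T : List Thread) : List Lit := T.flatMap Thread.ends

lemma length_endOccs (T : List Thread) : (endOccs T).length = 2 * T.length := by
  induction T with
  | nil => rfl
  | cons θ T ih =>
    simp only [endOccs, List.flatMap_cons, List.length_append, Thread.ends, List.length_cons,
      List.length_nil] at ih ⊢
    omega

/-- A decomposition of `F` into threads whose interiors use pairwise distinct variables,
with `#threads + #interior variables = #clauses`. -/
structure ThreadDecomp (F : Finset (Finset Lit)) (T : List Thread) : Prop where
  cover : ∀ C, C ∈ F ↔ ∃ θ ∈ T, C ∈ chainClauses θ.lits
  nodup : ((innerLits T).map Prod.fst).Nodup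
  disj : ∀ θ ∈ T, θ.src.1 ∉ (innerLits T).map Prod.fst ∧ θ.tgt.1 ∉ (innerLits T).map Prod.fst
  count : T.length + (innerLits T).length = F.card

namespace ThreadDecomp

variable {F : Finset (Finset Lit)} {T T' : List Thread}

lemma perm (h : ThreadDecomp F T) (hp : T.Perm T') : ThreadDecomp F T' := by
  have hi : (innerLits T).Perm (innerLits T') := hp.flatMap_right _
  have hi' := hi.map Prod.fst
  refine ⟨fun C => ?_, hi'.nodup_iff.1 h.nodup, fun θ hθ => ?_, ?_⟩
  · rw [h.cover C]; simp only [hp.mem_iff]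
  · rw [← hi'.mem_iff, ← hi'.mem_iff]; exact h.disj θ (hp.mem_iff.2 hθ)
  · rw [← hp.length_eq, ← hi.length_eq, h.count]

lemma flip_head {θ : Thread} (h : ThreadDecomp F (θ :: T)) : ThreadDecomp F (θ.flip :: T) := by
  have hp : ((innerLits (θ.flip :: T)).map Prod.fst).Perm ((innerLits (θ :: T)).map Prod.fst) := by
    simp only [innerLits, List.flatMap_cons, List.map_append, Thread.map_fst_mid_flip]
    exact (List.reverse_perm _).append_right _
  refine ⟨fun C => ?_, hp.nodup_iff.2 h.nodup, fun η hη => ?_, ?_⟩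
  · rw [h.cover C]; simp [Thread.chainClauses_flip]
  · rw [hp.mem_iff, hp.mem_iff]
    rcases List.mem_cons.1 hη with rfl | hη
    · exact (h.disj θ (by simp)).symm
    · exact h.disj η (by simp [hη])
  · rw [← h.count]
    have := hp.length_eq
    simp only [List.length_map] at this
    simp [this]

lemma exists_orient {S : List Thread} {x : Lit} (hx : x ∈ endOccs T) (h : ThreadDecomp F (T ++ S)) :
    ∃ θ T', ThreadDecomp F (θ :: (T' ++ S)) ∧ θ.tgt = x ∧ (endOccs (θ :: T')).Perm (endOccs T) ∧
      T'.length + 1 = T.length := by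
  obtain ⟨θ, hθ, hxθ⟩ := List.mem_flatMap.1 hx
  obtain ⟨a, b, rfl⟩ := List.append_of_mem hθ
  have hp : (a ++ θ :: b).Perm (θ :: (a ++ b)) := List.perm_middle
  have h' : ThreadDecomp F (θ :: (a ++ b ++ S)) := h.perm (hp.append_right S)
  have ho : (endOccs (θ :: (a ++ b))).Perm (endOccs (a ++ θ :: b)) := (hp.flatMap_right _).symm
  rcases (by simpa [Thread.ends] using hxθ : x = θ.src.compl ∨ x = θ.tgt) with rfl | rfl
  · refine ⟨θ.flip, a ++ b, h'.flip_head, rfl, ?_, by simp; omega⟩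
    refine List.Perm.trans ?_ ho
    simp only [endOccs, List.flatMap_cons]
    exact (Thread.ends_flip θ).append_right _
  · exact ⟨θ, a ++ b, h', rfl, ho, by simp; omega⟩

lemma merge {s x t : Lit} {m₁ m₂ : List Lit}
    (h : ThreadDecomp F (⟨s, m₁, x⟩ :: ⟨x, m₂, t⟩ :: T)) (hs : s.1 ≠ x.1) (ht : t.1 ≠ x.1)
    (hT : x.1 ∉ (endOccs T).map Prod.fst) : ThreadDecomp F (⟨s, m₁ ++ x :: m₂, t⟩ :: T) := by
  have hx := h.disj ⟨x, m₂, t⟩ (by simp)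
  have hs' := h.disj ⟨s, m₁, x⟩ (by simp)
  have hnd := h.nodup
  have hp : ((innerLits (⟨s, m₁ ++ x :: m₂, t⟩ :: T)).map Prod.fst).Perm
      (x.1 :: (innerLits (⟨s, m₁, x⟩ :: ⟨x, m₂, t⟩ :: T)).map Prod.fst) := by
    simp only [innerLits, List.flatMap_cons, List.map_append, List.map_cons, List.append_assoc,
      List.cons_append]
    exact List.perm_middle
  refine ⟨fun C => ?_, ?_, fun θ hθ => ?_, ?_⟩
  · rw [h.cover C]
    have : chainClauses (Thread.lits ⟨s, m₁ ++ x :: m₂, t⟩) =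
        chainClauses (Thread.lits ⟨s, m₁, x⟩) ∪ chainClauses (Thread.lits ⟨x, m₂, t⟩) := by
      have := chainClauses_append (s :: m₁) x (m₂ ++ [t])
      simpa [Thread.lits] using this
    simp [this, or_assoc]
  · rw [hp.nodup_iff, List.nodup_cons]
    exact ⟨hx.1, hnd⟩
  · rw [hp.mem_iff, hp.mem_iff, List.mem_cons, List.mem_cons]
    push Not
    rcases List.mem_cons.1 hθ with rfl | hθ
    · exact ⟨⟨hs, hs'.1⟩, ht, hx.2⟩
    · have h1 : θ.src.1 ≠ x.1 := fun e =>
        hT (List.mem_map.2 ⟨θ.src.compl, List.mem_flatMap.2 ⟨θ, hθ, by simp [Thread.ends]⟩, e⟩)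
      have h2 : θ.tgt.1 ≠ x.1 := fun e =>
        hT (List.mem_map.2 ⟨θ.tgt, List.mem_flatMap.2 ⟨θ, hθ, by simp [Thread.ends]⟩, e⟩)
      have := h.disj θ (by simp [hθ])
      exact ⟨⟨h1, this.1⟩, h2, this.2⟩
  · rw [← h.count]
    have := hp.length_eq
    simp only [List.length_map, List.length_cons] at this ⊢
    omega

/-- A thread closing up on an otherwise unused literal contradicts minimal unsatisfiability. -/
lemma not_loop (hF : MU F) {x : Lit} {m : List Lit} (h : ThreadDecomp F (⟨x, m, x⟩ :: T))
    (hT : x.1 ∉ (endOccs T).map Prod.fst) : False := by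
  classical
  have hnd := h.nodup
  have hx := (h.disj ⟨x, m, x⟩ (by simp)).1
  have hi : innerLits (⟨x, m, x⟩ :: T) = m ++ innerLits T := rfl
  rw [hi, List.map_append] at hnd hx
  have hnd' : ((m ++ [x]).map Prod.fst).Nodup := by
    rw [List.map_append, List.nodup_append]
    refine ⟨hnd.of_append_left, by simp, ?_⟩
    rintro a ha b hb rfl
    exact hx (List.mem_append_left _ (by simp at hb; simpa [hb] using ha))
  let φ : ℕ → Bool := fun v => decide ((v, true) ∈ m ++ [x])
  have hφ : ∀ y ∈ m ++ [x], LitVal φ y = true := by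
    rintro ⟨v, b⟩ hy
    cases b
    · have : (v, true) ∉ m ++ [x] := fun hy' => by
        have := List.inj_on_of_nodup_map hnd' hy hy' rfl
        simp at this
      simpa [LitVal, φ] using this
    · simp only [LitVal, φ, if_true]; exact decide_eq_true hy
  have hmem : ({x.compl, (m ++ [x]).head (by simp)} : Finset Lit) ∈ F := by
    rw [h.cover]
    refine ⟨⟨x, m, x⟩, by simp, ?_⟩
    cases m <;> simp [Thread.lits, chainClauses]
  refine hF.not_touches_of_autarky {v | v ∈ (m ++ [x]).map Prod.fst} φ ?_ _ hmem x.compl (by simp)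
    (by simp)
  rintro C hC ⟨z, hz, hzV⟩
  obtain ⟨θ, hθ, hCθ⟩ := (h.cover C).1 hC
  rcases List.mem_cons.1 hθ with rfl | hθ
  · obtain ⟨y, hy, hyC⟩ := exists_mem_tail_of_mem_chainClauses hCθ
    exact ⟨y, hyC, List.mem_map_of_mem hy, hφ y hy⟩
  · exfalso
    have hzV : z.1 ∈ m.map Prod.fst ∨ z.1 = x.1 := by
      simpa only [Set.mem_ofPred_eq, List.map_append, List.mem_append, List.map_cons, List.map_nil,
        List.mem_singleton] using hzV
    have hend : z ∈ θ.ends ∨ z.1 ∈ (innerLits T).map Prod.fst := by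
      rcases eq_or_of_mem_chainClauses hCθ hz with h1 | h1 | h1
      · simp [Thread.ends, h1]
      · simp [Thread.ends, h1]
      · right
        obtain ⟨w, hw, hwz⟩ := List.mem_map.1 h1
        exact List.mem_map.2 ⟨w, List.mem_flatMap.2 ⟨θ, hθ, hw⟩, hwz⟩
    rcases hend with hend | hend
    · rcases hzV with hzV | hzV
      · have := h.disj θ (by simp [hθ])
        rw [hi, List.map_append] at this
        rcases (by simpa [Thread.ends] using hend : z = θ.src.compl ∨ z = θ.tgt) with rfl | rfl
        · exact this.1 (List.mem_append_left _ hzV)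
        · exact this.2 (List.mem_append_left _ hzV)
      · exact hT (List.mem_map.2 ⟨z, List.mem_flatMap.2 ⟨θ, hθ, hend⟩, hzV⟩)
    · rcases hzV with hzV | hzV
      · exact (List.nodup_append.1 hnd).2.2 _ hzV _ hend rfl
      · exact hx (List.mem_append_right _ (hzV ▸ hend))

lemma mem_endOccs (h : ThreadDecomp F T) {C : Finset Lit} (hC : C ∈ F) {x : Lit} (hx : x ∈ C)
    (hi : x.1 ∉ (innerLits T).map Prod.fst) : x ∈ endOccs T := by
  obtain ⟨θ, hθ, hCθ⟩ := (h.cover C).1 hC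
  refine List.mem_flatMap.2 ⟨θ, hθ, ?_⟩
  rcases eq_or_of_mem_chainClauses hCθ hx with h1 | h1 | h1
  · simp [Thread.ends, h1]
  · simp [Thread.ends, h1]
  · obtain ⟨w, hw, hwz⟩ := List.mem_map.1 h1
    exact absurd (List.mem_map.2 ⟨w, List.mem_flatMap.2 ⟨θ, hθ, hw⟩, hwz⟩) hi

lemma fst_mem_varsOf (h : ThreadDecomp F T) {θ : Thread} (hθ : θ ∈ T) {x : Lit}
    (hx : x ∈ θ.lits) : x.1 ∈ varsOf F := by
  obtain ⟨C, hC, z, hz, hzx⟩ := exists_mem_chainClauses (by simp [Thread.lits]) hx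
  exact mem_varsOf.2 ⟨C, (h.cover C).2 ⟨θ, hθ, hC⟩, z, hz, hzx⟩

lemma innerLits_subset (h : ThreadDecomp F T) :
    ∀ v ∈ (innerLits T).map Prod.fst, v ∈ varsOf F := by
  intro v hv
  obtain ⟨x, hx, rfl⟩ := List.mem_map.1 hv
  obtain ⟨θ, hθ, hxθ⟩ := List.mem_flatMap.1 hx
  exact h.fst_mem_varsOf hθ (by simp [Thread.lits, hxθ])

/-- The variables occurring at ends of threads. -/
def endVars (F : Finset (Finset Lit)) (T : List Thread) : Finset ℕ :=
  varsOf F \ ((innerLits T).map Prod.fst).toFinset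

lemma mem_endVars {v : ℕ} :
    v ∈ endVars F T ↔ v ∈ varsOf F ∧ v ∉ (innerLits T).map Prod.fst := by
  simp only [endVars, Finset.mem_sdiff, List.mem_toFinset]

lemma card_endVars (h : ThreadDecomp F T) :
    (endVars F T).card + (innerLits T).length = (varsOf F).card := by
  have hsub : ((innerLits T).map Prod.fst).toFinset ⊆ varsOf F := fun v hv =>
    h.innerLits_subset v (List.mem_toFinset.1 hv)
  have := Finset.card_sdiff_add_card_eq_card hsub
  rwa [List.toFinset_card_of_nodup h.nodup, List.length_map] at this

/-- In a shortest decomposition, each end variable occurs at least three times at ends. -/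
lemma three_le_count (hF : MU F) (h : ThreadDecomp F T)
    (hmin : ∀ T', ThreadDecomp F T' → T.length ≤ T'.length) {v : ℕ} (hv : v ∈ endVars F T) :
    3 ≤ ((endOccs T).map Prod.fst).count v := by
  by_contra! hlt
  rw [mem_endVars] at hv
  have hocc : ∀ b, (v, b) ∈ endOccs T := fun b => by
    obtain ⟨C, hC, hx⟩ := hF.exists_mem_of_mem_litsOf (x := (v, b)) (mem_litsOf.2 hv.1)
    exact h.mem_endOccs hC hx hv.2
  obtain ⟨⟨s, m, x⟩, T₁, h₁, hx, hp₁, hl₁⟩ :=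
    exists_orient (S := []) (hocc true) (by simpa using h)
  simp only at hx
  subst hx
  rw [List.append_nil] at h₁
  have hc := (hp₁.map Prod.fst).count_eq v
  simp only [endOccs, List.flatMap_cons, Thread.ends, List.map_cons, List.cons_append, List.nil_append, Lit.compl_fst, List.count_cons,
    beq_self_eq_true, if_true] at hc
  have hfalse : Lit.compl (v, true) ∈ endOccs (⟨s, m, (v, true)⟩ :: T₁) :=
    hp₁.mem_iff.2 (hocc false)
  simp only [endOccs, List.flatMap_cons, Thread.ends, List.cons_append, List.nil_append,
    List.mem_cons, Lit.compl_inj, Lit.compl_ne, false_or] at hfalse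
  rcases hfalse with rfl | hfalse
  · refine not_loop hF h₁ ?_
    rw [← List.count_eq_zero]
    simp only [beq_self_eq_true, if_true] at hc
    simp only [endOccs] at hlt ⊢
    omega
  · obtain ⟨θ, T₂, h₂, hx, hp₂, hl₂⟩ := exists_orient (S := [⟨s, m, (v, true)⟩])
      (T := T₁) hfalse (h₁.perm (List.perm_append_singleton _ _).symm)
    have h₃ := (h₂.flip_head.perm (List.perm_append_singleton (⟨s, m, (v, true)⟩ : Thread)
      (θ.flip :: T₂)))
    have hc₂ := (hp₂.map Prod.fst).count_eq v
    simp only [endOccs, List.flatMap_cons, Thread.ends, List.map_cons, hx, List.cons_append,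
      List.nil_append, Lit.compl_fst, List.count_cons,
      beq_self_eq_true, if_true] at hc₂ hlt
    rw [← hc₂] at hc
    have hs : s.1 ≠ v := by
      intro e
      rw [e] at hc
      simp only [beq_self_eq_true, if_true] at hc
      omega
    have ht : θ.src.1 ≠ v := by
      intro e
      rw [e] at hc
      simp only [beq_self_eq_true, if_true] at hc
      omega
    have h₄ : ThreadDecomp F
        (⟨s, m, (v, true)⟩ :: ⟨(v, true), θ.mid.reverse.map Lit.compl, θ.src.compl⟩ :: T₂) := by
      have : θ.flip = ⟨(v, true), θ.mid.reverse.map Lit.compl, θ.src.compl⟩ := by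
        simp [Thread.flip, hx]
      rwa [this] at h₃
    have := hmin _ (h₄.merge hs ht (by
      rw [← List.count_eq_zero]
      simp only [endOccs]
      omega))
    simp only [List.length_cons] at this
    omega

lemma exists_initial (hF : MU2 F) (h0 : ∅ ∉ F) : ∃ T, ThreadDecomp F T := by
  have hex : ∀ C ∈ F, ∃ a b : Lit, C = {a.compl, b} := by
    intro C hC
    have h2 := hF.2 C hC
    have h1 : C.card ≠ 0 := fun h => h0 (Finset.card_eq_zero.1 h ▸ hC)
    rcases (by omega : C.card = 1 ∨ C.card = 2) with h | h
    · obtain ⟨a, rfl⟩ := Finset.card_eq_one.1 h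
      exact ⟨a.compl, a, by simp⟩
    · obtain ⟨a, b, -, rfl⟩ := Finset.card_eq_two.1 h
      exact ⟨a.compl, b, by simp⟩
  choose! a b hab using hex
  have hi : innerLits (F.toList.map fun C => (⟨a C, [], b C⟩ : Thread)) = [] := by
    simp [innerLits, List.flatMap_map]
  refine ⟨F.toList.map fun C => ⟨a C, [], b C⟩, fun C => ?_, by simp [hi], by simp [hi],
    by simp [hi]⟩
  simp only [List.mem_map, Finset.mem_toList, exists_exists_and_eq_and, Thread.lits,
    List.nil_append, chainClauses, insert_empty_eq, Finset.mem_singleton]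
  constructor
  · exact fun hC => ⟨C, hC, hab C hC⟩
  · rintro ⟨D, hD, rfl⟩
    rwa [← hab D hD]

/-- A minimally unsatisfiable 2-clause-set of deficiency `k` decomposes into at most `3 * k`
threads. -/
lemma exists_length_le (hF : MU2 F) (h0 : ∅ ∉ F) {k : ℕ} (hk : F.card = (varsOf F).card + k) :
    ∃ T, ThreadDecomp F T ∧ T.length ≤ 3 * k ∧ (endVars F T).card + k = T.length := by
  classical
  have hex : ∃ n T, ThreadDecomp F T ∧ T.length = n := by
    obtain ⟨T, hT⟩ := exists_initial hF h0
    exact ⟨_, T, hT, rfl⟩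
  obtain ⟨T, hT, hlen⟩ := Nat.find_spec hex
  have hmin : ∀ T', ThreadDecomp F T' → T.length ≤ T'.length := fun T' hT' => by
    rw [hlen]; exact Nat.find_min' hex ⟨T', hT', rfl⟩
  have hcard := hT.card_endVars
  have hcount := hT.count
  have hsum : ∑ v ∈ endVars F T, ((endOccs T).map Prod.fst).count v =
      ((endOccs T).map Prod.fst).length := by
    have := Multiset.sum_count_eq_card (s := endVars F T)
      (m := (((endOccs T).map Prod.fst : List ℕ) : Multiset ℕ)) ?_
    · simpa using this
    · intro v hv
      obtain ⟨x, hx, rfl⟩ := List.mem_map.1 (Multiset.mem_coe.1 hv)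
      obtain ⟨θ, hθ, hxθ⟩ := List.mem_flatMap.1 hx
      rw [mem_endVars]
      rcases (by simpa [Thread.ends] using hxθ : x = θ.src.compl ∨ x = θ.tgt) with rfl | rfl
      · exact ⟨hT.fst_mem_varsOf hθ (x := θ.src) (by simp [Thread.lits]), (hT.disj θ hθ).1⟩
      · exact ⟨hT.fst_mem_varsOf hθ (by simp [Thread.lits]), (hT.disj θ hθ).2⟩
  have hle : (endVars F T).card * 3 ≤ ∑ v ∈ endVars F T, ((endOccs T).map Prod.fst).count v := by
    rw [← smul_eq_mul]
    exact Finset.card_nsmul_le_sum _ _ _ fun v hv => three_le_count hF.1 hT hmin hv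
  rw [hsum, List.length_map, length_endOccs] at hle
  exact ⟨T, hT, by omega, by omega⟩

end ThreadDecomp

end Threads

section Relabelling

/-- Relabel the literals canonically: interior variables by their
position, end variables by the index `idx`. -/
def relabel (T : List Thread) (idx : ℕ → ℕ) (x : Lit) : Lit :=
  if x.1 ∈ (innerLits T).map Prod.fst then
    (Nat.pair 1 (((innerLits T).map Prod.fst).idxOf x.1), x.2 == decide ((x.1, true) ∈ innerLits T))
  else (Nat.pair 0 (idx x.1), x.2)

lemma relabel_compl (T : List Thread) (idx : ℕ → ℕ) (x : Lit) :
    relabel T idx x.compl = (relabel T idx x).compl := by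
  by_cases h : x.1 ∈ (innerLits T).map Prod.fst
  · rw [relabel, relabel, if_pos h, if_pos (by exact h)]
    refine Prod.ext rfl ?_
    change ((!x.2) == decide ((x.1, true) ∈ innerLits T)) =
      !(x.2 == decide ((x.1, true) ∈ innerLits T))
    cases x.2 <;> cases decide ((x.1, true) ∈ innerLits T) <;> rfl
  · rw [relabel, relabel, if_neg h, if_neg (by exact h)]
    rfl

lemma relabel_of_notMem {T : List Thread} {idx : ℕ → ℕ} {x : Lit}
    (h : x.1 ∉ (innerLits T).map Prod.fst) : relabel T idx x = (Nat.pair 0 (idx x.1), x.2) :=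
  if_neg h

lemma map_relabel_innerLits {T : List Thread} (h : ((innerLits T).map Prod.fst).Nodup)
    (idx : ℕ → ℕ) : (innerLits T).map (relabel T idx) =
      (List.range (innerLits T).length).map fun i => (Nat.pair 1 i, true) := by
  apply List.ext_getElem (by simp)
  intro i h₁ h₂
  rw [List.length_map] at h₁
  simp only [List.getElem_map, List.getElem_range]
  have hmem : (innerLits T)[i] ∈ innerLits T := List.getElem_mem h₁
  have hidx : ((innerLits T).map Prod.fst).idxOf (innerLits T)[i].1 = i := by
    have := h.idxOf_getElem i (by simpa using h₁)
    simpa only [List.getElem_map] using this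
  rw [relabel, if_pos (List.mem_map_of_mem hmem), hidx]
  congr 1
  generalize (innerLits T)[i] = x at hmem
  rcases x with ⟨v, b⟩
  cases b
  · have : (v, true) ∉ innerLits T := fun hy' => by
      have := List.inj_on_of_nodup_map h hmem hy' rfl
      simp at this
    simp [this]
  · simp [hmem]

lemma ThreadDecomp.relabel_injOn {F : Finset (Finset Lit)} {T : List Thread} {idx : ℕ → ℕ}
    (hidx : Set.InjOn idx ↑(ThreadDecomp.endVars F T)) :
    Set.InjOn (relabel T idx) ↑(litsOf F) := by
  rintro ⟨v, b⟩ hx ⟨w, c⟩ hy hxy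
  have hv := mem_litsOf.1 (Finset.mem_coe.1 hx)
  have hw := mem_litsOf.1 (Finset.mem_coe.1 hy)
  by_cases h₁ : v ∈ (innerLits T).map Prod.fst <;> by_cases h₂ : w ∈ (innerLits T).map Prod.fst <;>
    simp only [relabel, h₁, h₂, if_true, if_false, Prod.mk.injEq, Nat.pair_eq_pair] at hxy
  · obtain rfl : v = w := (List.idxOf_inj h₁).1 hxy.1.2
    have h := hxy.2
    revert h
    generalize decide ((v, true) ∈ innerLits T) = d
    cases b <;> cases c <;> cases d <;> simp
  · omega
  · omega
  · obtain rfl : v = w := hidx (by simpa [ThreadDecomp.mem_endVars] using ⟨hv, by simpa using h₁⟩)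
      (by simpa [ThreadDecomp.mem_endVars] using ⟨hw, by simpa using h₂⟩) hxy.1.2
    simp [hxy.2]

lemma ThreadDecomp.image_relabel {F : Finset (Finset Lit)} {T : List Thread}
    (h : ThreadDecomp F T) (idx : ℕ → ℕ) (C : Finset Lit) :
    C ∈ F.image (fun C => C.image (relabel T idx)) ↔
      ∃ l ∈ T.map (fun θ => θ.lits.map (relabel T idx)), C ∈ chainClauses l := by
  simp only [List.mem_map, exists_exists_and_eq_and,
    chainClauses_map _ (relabel_compl T idx), Finset.mem_image]
  constructor
  · rintro ⟨D, hD, rfl⟩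
    obtain ⟨θ, hθ, hDθ⟩ := (h.cover D).1 hD
    exact ⟨θ, hθ, D, hDθ, rfl⟩
  · rintro ⟨θ, hθ, D, hDθ, rfl⟩
    exact ⟨D, (h.cover D).2 ⟨θ, hθ, hDθ⟩, rfl⟩

lemma List.eq_of_sum_eq {l l' : List ℕ} {m : ℕ} (hl : l.length = l'.length)
    (hm : l.length ≤ m + 1) (h : ∀ j < m, l[j]? = l'[j]?) (hs : l.sum = l'.sum) : l = l' := by
  have ht : l.take m = l'.take m := by
    apply List.ext_getElem?
    intro i
    rw [List.getElem?_take, List.getElem?_take]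
    split_ifs with hi
    · exact h i hi
    · rfl
  have hd : (l.drop m).sum = (l'.drop m).sum := by
    have h₁ := List.sum_take_add_sum_drop l m
    have h₂ := List.sum_take_add_sum_drop l' m
    rw [ht] at h₁
    omega
  have hd' : l.drop m = l'.drop m := by
    have h₁ : (l.drop m).length ≤ 1 := by rw [List.length_drop]; omega
    have h₂ : (l.drop m).length = (l'.drop m).length := by simp [hl]
    generalize l.drop m = a at *
    generalize l'.drop m = b at *
    match a, b with
    | [], [] => rfl
    | [x], [y] => simpa using hd
    | [], _ :: _ => simp at h₂
    | _ :: _, [] => simp at h₂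
    | _ :: _ :: _, _ => simp at h₁
    | [_], _ :: _ :: _ => simp at h₂
  rw [← List.take_append_drop m l, ht, hd', List.take_append_drop]

/-- Decompositions with the same end pattern and the same lengths give isomorphic clause-sets. -/
lemma ThreadDecomp.exists_cnfIso {F F' : Finset (Finset Lit)} {T T' : List Thread}
    (h : ThreadDecomp F T) (h' : ThreadDecomp F' T') {idx idx' : ℕ → ℕ}
    (hidx : Set.InjOn idx ↑(ThreadDecomp.endVars F T))
    (hidx' : Set.InjOn idx' ↑(ThreadDecomp.endVars F' T'))
    (hlen : T.map (fun θ => θ.mid.length) = T'.map (fun θ => θ.mid.length))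
    (hends : T.map (fun θ => ((idx θ.src.1, θ.src.2), (idx θ.tgt.1, θ.tgt.2))) =
      T'.map (fun θ => ((idx' θ.src.1, θ.src.2), (idx' θ.tgt.1, θ.tgt.2)))) :
    ∃ f, CNFIso F F' f := by
  have hL : ∀ S : List Thread, (innerLits S).length = (S.map (fun θ => θ.mid.length)).sum :=
    fun S => by simp [innerLits, List.length_flatMap]
  have hfl : ∀ (S : List Thread) (g : Lit → Lit),
      (S.map (fun θ => θ.mid.map g)).flatten = (innerLits S).map g := fun S g => by
    induction S with
    | nil => rfl
    | cons θ S ih => simpa [innerLits] using ih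
  have hmid : T.map (fun θ => θ.mid.map (relabel T idx)) =
      T'.map (fun θ => θ.mid.map (relabel T' idx')) := by
    rw [List.eq_iff_flatten_eq]
    constructor
    · rw [hfl, hfl, map_relabel_innerLits h.nodup, map_relabel_innerLits h'.nodup, hL, hL, hlen]
    · simpa [Function.comp_def] using hlen
  have hlits : T.map (fun θ => θ.lits.map (relabel T idx)) =
      T'.map (fun θ => θ.lits.map (relabel T' idx')) := by
    have hl : T.length = T'.length := by simpa using congrArg List.length hlen
    apply List.ext_getElem (by simpa using hl)
    intro i h₁ h₂
    rw [List.length_map] at h₁ h₂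
    have e₁ := List.getElem_of_eq hmid (i := i) (by simpa using h₁)
    have e₂ := List.getElem_of_eq hends (i := i) (by simpa using h₁)
    simp only [List.getElem_map, Prod.mk.injEq] at e₁ e₂ ⊢
    have d := h.disj _ (List.getElem_mem h₁)
    have d' := h'.disj _ (List.getElem_mem h₂)
    simp only [Thread.lits, List.map_cons, List.map_append, List.map_nil, e₁,
      relabel_of_notMem d.1, relabel_of_notMem d.2, relabel_of_notMem d'.1,
      relabel_of_notMem d'.2, e₂]
  refine exists_cnfIso_of_image_eq (relabel_injOn hidx) (relabel_injOn hidx')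
    (fun x _ => relabel_compl _ _ x) (fun x _ => relabel_compl _ _ x) ?_
  ext C
  rw [h.image_relabel, h'.image_relabel, hlits]

end Relabelling

section UpperBound

lemma MU.eq_of_empty_mem {F : Finset (Finset Lit)} (hF : MU F) (h : ∅ ∈ F) : F = {∅} := by
  by_contra hne
  have hss : ({∅} : Finset (Finset Lit)) ⊂ F :=
    Finset.ssubset_iff_subset_ne.2 ⟨Finset.singleton_subset_iff.2 h, Ne.symm hne⟩
  obtain ⟨φ, hφ⟩ := hF.2.2 _ hss
  simpa using hφ ∅ (by simp)

/-- Finitely many data, of order `n ^ (3 * k - 1)`, determining a clause-set up to isomorphism. -/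
abbrev ThreadData (k n : ℕ) : Type :=
  Fin (3 * k + 1) × (Fin (3 * k) → Option ((Fin (2 * k) × Bool) × (Fin (2 * k) × Bool))) ×
    (Fin (3 * k - 1) → Fin (n + 1))

lemma exists_decomp_of_MU2dn {k n : ℕ} (hk : 2 ≤ k) (F : MU2dn (k : ℤ) n) :
    ∃ (T : List Thread) (idx : ℕ → Fin (2 * k)), ThreadDecomp F.1 T ∧ T.length ≤ 3 * k ∧
      T.length + (innerLits T).length = n + k ∧
      Set.InjOn idx ↑(ThreadDecomp.endVars F.1 T) ∧ (innerLits T).length ≤ n := by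
  obtain ⟨F, hF, hd, hn⟩ := F
  have hcard : F.card = (varsOf F).card + k := by
    unfold deficiency at hd
    omega
  have h0 : ∅ ∉ F := fun h => by
    have := hF.1.eq_of_empty_mem h
    subst this
    simp at hcard
    omega
  obtain ⟨T, hT, hlen, hE⟩ := ThreadDecomp.exists_length_le hF h0 hcard
  have hcount := hT.count
  have hle : Fintype.card (ThreadDecomp.endVars F T) ≤ Fintype.card (Fin (2 * k)) := by
    simp only [Fintype.card_coe, Fintype.card_fin]
    omega
  obtain ⟨e⟩ := Function.Embedding.nonempty_of_card_le hle
  refine ⟨T, fun v => if h : v ∈ ThreadDecomp.endVars F T then e ⟨v, h⟩ else ⟨0, by omega⟩,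
    hT, hlen, by omega, ?_, ?_⟩
  · intro v hv w hw hvw
    have hv' := Finset.mem_coe.1 hv
    have hw' := Finset.mem_coe.1 hw
    simp only [hv', hw', dif_pos] at hvw
    simpa using e.injective hvw
  · have := hT.card_endVars
    omega

lemma exists_encoding {k n : ℕ} (hk : 2 ≤ k) :
    ∃ enc : MU2dn (k : ℤ) n → ThreadData k n, ∀ F F', enc F = enc F' → isoRel F F' := by
  choose T idx hT hlen hcount hidx hle using exists_decomp_of_MU2dn (n := n) hk
  refine ⟨fun F => (Fin.ofNat _ (T F).length,
    fun j => ((T F).map fun θ =>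
      ((idx F θ.src.1, θ.src.2), (idx F θ.tgt.1, θ.tgt.2)))[(j : ℕ)]?,
    fun j => Fin.ofNat _ ((((T F).map fun θ => θ.mid.length)[(j : ℕ)]?).getD 0)), ?_⟩
  intro F F' hFF
  simp only [Prod.mk.injEq] at hFF
  obtain ⟨h₁, h₂, h₃⟩ := hFF
  have hl : (T F).length = (T F').length := by
    have := congrArg Fin.val h₁
    simp only [Fin.ofNat] at this
    rwa [Nat.mod_eq_of_lt (by have := hlen F; omega),
      Nat.mod_eq_of_lt (by have := hlen F'; omega)] at this
  have hends := List.ext_getElem? (l₁ := (T F).map fun θ =>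
      ((idx F θ.src.1, θ.src.2), (idx F θ.tgt.1, θ.tgt.2))) (l₂ := (T F').map fun θ =>
      ((idx F' θ.src.1, θ.src.2), (idx F' θ.tgt.1, θ.tgt.2))) fun i => by
    by_cases hi : i < 3 * k
    · exact congrFun h₂ ⟨i, hi⟩
    · have := hlen F
      rw [List.getElem?_eq_none (by rw [List.length_map]; omega),
        List.getElem?_eq_none (by rw [List.length_map]; omega)]
  have hsum : ∀ F, ((T F).map fun θ => θ.mid.length).sum = (innerLits (T F)).length :=
    fun F => by simp [innerLits, List.length_flatMap]
  have hbd : ∀ F (j : ℕ), (((T F).map fun θ => θ.mid.length)[j]?).getD 0 < n + 1 := fun F j => by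
    by_cases hj : j < (T F).length
    · have hm : (((T F).map fun θ => θ.mid.length)[j]?).getD 0 ∈
          (T F).map fun θ => θ.mid.length := by
        rw [List.getElem?_eq_getElem (by simpa using hj), Option.getD_some]
        exact List.getElem_mem _
      have := List.single_le_sum (by simp) _ hm
      have := hle F
      have := hsum F
      omega
    · simp [hj]
  have hlens : ((T F).map fun θ => θ.mid.length) = (T F').map fun θ => θ.mid.length := by
    refine List.eq_of_sum_eq (m := 3 * k - 1) (by simpa using hl) ?_ ?_ ?_
    · rw [List.length_map]
      have := hlen F
      omega
    · intro j hj
      have := congrArg Fin.val (congrFun h₃ ⟨j, hj⟩)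
      simp only [Fin.ofNat] at this
      rw [Nat.mod_eq_of_lt (hbd F j), Nat.mod_eq_of_lt (hbd F' j)] at this
      by_cases hjT : j < (T F).length
      · rw [List.getElem?_eq_getElem (by simpa using hjT),
          List.getElem?_eq_getElem (by simpa [← hl] using hjT)] at this ⊢
        simpa using this
      · rw [List.getElem?_eq_none (by simpa using hjT),
          List.getElem?_eq_none (by simpa [← hl] using hjT)]
    · rw [hsum, hsum]
      have := hcount F
      have := hcount F'
      omega
  refine (hT F).exists_cnfIso (hT F') (idx := fun v => idx F v) (idx' := fun v => idx F' v)
    (Fin.val_injective.comp_injOn (hidx F)) (Fin.val_injective.comp_injOn (hidx F')) hlens ?_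
  have := congrArg (List.map fun p : (Fin (2 * k) × Bool) × (Fin (2 * k) × Bool) =>
    (((p.1.1 : ℕ), p.1.2), ((p.2.1 : ℕ), p.2.2))) hends
  simpa [Function.comp_def] using this

lemma exists_injective_quot {k n : ℕ} (hk : 2 ≤ k) :
    ∃ f : Quot (@isoRel (k : ℤ) n) → ThreadData k n, Function.Injective f := by
  obtain ⟨enc, henc⟩ := exists_encoding (n := n) hk
  refine ⟨fun q => enc q.out, fun q q' h => ?_⟩
  rw [← q.out_eq, ← q'.out_eq]
  exact Quot.sound (henc _ _ h)

lemma finite_quot {k n : ℕ} (hk : 2 ≤ k) : Finite (Quot (@isoRel (k : ℤ) n)) := by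
  obtain ⟨f, hf⟩ := exists_injective_quot (n := n) hk
  exact Finite.of_injective f hf

lemma numClasses_le {k n : ℕ} (hk : 2 ≤ k) :
    numClasses (k : ℤ) n ≤
      (3 * k + 1) * ((2 * k * 2 * (2 * k * 2) + 1) ^ (3 * k) * (n + 1) ^ (3 * k - 1)) := by
  obtain ⟨f, hf⟩ := exists_injective_quot (n := n) hk
  refine (Nat.card_le_card_of_injective f hf).trans_eq ?_
  simp [Nat.card_eq_fintype_card]

end UpperBound


section LowerBoundFamily

/-- The literals `innLit k i` and `outLit k i` for `i ≤ k` are the end literals of the threads. -/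
def innLit (k i : ℕ) : Lit := if i < k then (Nat.pair 0 (2 * i), true) else (Nat.pair 0 1, false)

/-- See `innLit`. -/
def outLit (k i : ℕ) : Lit :=
  if i < k then (Nat.pair 0 (2 * i + 1), true) else (Nat.pair 0 0, false)

/-- The literal at the start of the `j`-th thread. -/
def srcLit (k j : ℕ) : Lit :=
  if j % 3 = 0 then innLit k (j / 3) else if j % 3 = 1 then outLit k (j / 3)
  else outLit k (j / 3 + 1)

/-- The literal at the end of the `j`-th thread. -/
def tgtLit (k j : ℕ) : Lit :=
  if j % 3 = 0 then outLit k (j / 3) else if j % 3 = 1 then innLit k (j / 3 + 1)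
  else innLit k (j / 3)

/-- The `p`-th literal on the `j`-th thread, where the thread has `ℓ j` interior literals. -/
def node (k : ℕ) (ℓ : ℕ → ℕ) (j p : ℕ) : Lit :=
  if p = 0 then srcLit k j else if p ≤ ℓ j then (Nat.pair (j + 1) p, true) else tgtLit k j

/-- The `p`-th clause of the `j`-th thread. -/
def threadClause (k : ℕ) (ℓ : ℕ → ℕ) (j p : ℕ) : Finset Lit :=
  {(node k ℓ j p).compl, node k ℓ j (p + 1)}

/-- The clause-set consisting of `3 * k` threads with `ℓ j` interior literals, arranged as a
Möbius ladder. -/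
def ladder (k : ℕ) (ℓ : ℕ → ℕ) : Finset (Finset Lit) :=
  ((Finset.range (3 * k)).sigma fun j => Finset.range (ℓ j + 1)).image
    fun s => threadClause k ℓ s.1 s.2

variable {k : ℕ} {ℓ : ℕ → ℕ}

lemma mem_ladder {C : Finset Lit} :
    C ∈ ladder k ℓ ↔ ∃ j p, j < 3 * k ∧ p ≤ ℓ j ∧ threadClause k ℓ j p = C := by
  simp only [ladder, Finset.mem_image, Finset.mem_sigma, Finset.mem_range, Sigma.exists,
    Nat.lt_succ_iff, and_assoc]

lemma threadClause_mem {j p : ℕ} (hj : j < 3 * k) (hp : p ≤ ℓ j) :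
    threadClause k ℓ j p ∈ ladder k ℓ :=
  mem_ladder.2 ⟨j, p, hj, hp, rfl⟩

lemma innLit_self (hk : 0 < k) : innLit k k = (outLit k 0).compl := by
  simp [innLit, outLit, hk, Lit.compl]

lemma outLit_self (hk : 0 < k) : outLit k k = (innLit k 0).compl := by
  simp [innLit, outLit, hk, Lit.compl]

lemma innLit_fst (hk : 0 < k) (i : ℕ) : ∃ m < 2 * k, (innLit k i).1 = Nat.pair 0 m := by
  unfold innLit
  split_ifs with h
  · exact ⟨2 * i, by omega, rfl⟩
  · exact ⟨1, by omega, rfl⟩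

lemma outLit_fst (hk : 0 < k) (i : ℕ) : ∃ m < 2 * k, (outLit k i).1 = Nat.pair 0 m := by
  unfold outLit
  split_ifs with h
  · exact ⟨2 * i + 1, by omega, rfl⟩
  · exact ⟨0, by omega, rfl⟩

lemma srcLit_fst (hk : 0 < k) (j : ℕ) : ∃ m < 2 * k, (srcLit k j).1 = Nat.pair 0 m := by
  unfold srcLit
  split_ifs
  exacts [innLit_fst hk _, outLit_fst hk _, outLit_fst hk _]

lemma tgtLit_fst (hk : 0 < k) (j : ℕ) : ∃ m < 2 * k, (tgtLit k j).1 = Nat.pair 0 m := by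
  unfold tgtLit
  split_ifs
  exacts [outLit_fst hk _, innLit_fst hk _, innLit_fst hk _]

lemma srcLit_ne (hk : 0 < k) (j a m : ℕ) (b : Bool) : srcLit k j ≠ (Nat.pair (a + 1) m, b) := by
  intro h
  obtain ⟨m', -, hm⟩ := srcLit_fst hk j
  rw [h] at hm
  simp at hm

lemma tgtLit_ne (hk : 0 < k) (j a m : ℕ) (b : Bool) : tgtLit k j ≠ (Nat.pair (a + 1) m, b) := by
  intro h
  obtain ⟨m', -, hm⟩ := tgtLit_fst hk j
  rw [h] at hm
  simp at hm

@[simp] lemma node_zero (j : ℕ) : node k ℓ j 0 = srcLit k j := rfl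

@[simp] lemma node_last (j : ℕ) : node k ℓ j (ℓ j + 1) = tgtLit k j := by
  simp [node]

lemma node_of_mem {j p : ℕ} (h₁ : 1 ≤ p) (h₂ : p ≤ ℓ j) :
    node k ℓ j p = (Nat.pair (j + 1) p, true) := by
  rw [node, if_neg (by omega), if_pos h₂]

lemma node_eq_iff (hk : 0 < k) {j p j' p' : ℕ} {b : Bool} :
    node k ℓ j p = (Nat.pair (j' + 1) p', b) ↔
      b = true ∧ j = j' ∧ p = p' ∧ 1 ≤ p ∧ p ≤ ℓ j := by
  unfold node
  split_ifs with h₁ h₂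
  · simp [srcLit_ne hk, h₁]
  · simp only [Prod.mk.injEq, Nat.pair_eq_pair]
    grind
  · simp [tgtLit_ne hk, h₂]

lemma compl_node_eq_iff (hk : 0 < k) {j p j' p' : ℕ} {b : Bool} :
    (node k ℓ j p).compl = (Nat.pair (j' + 1) p', b) ↔
      b = false ∧ j = j' ∧ p = p' ∧ 1 ≤ p ∧ p ≤ ℓ j := by
  have : (node k ℓ j p).compl = (Nat.pair (j' + 1) p', b) ↔
      node k ℓ j p = (Nat.pair (j' + 1) p', !b) := by
    rw [← Lit.compl_inj, Lit.compl_compl]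
    rfl
  rw [this, node_eq_iff hk]
  simp

lemma mem_threadClause_iff (hk : 0 < k) {j p j' p' : ℕ} {b : Bool} :
    (Nat.pair (j' + 1) p', b) ∈ threadClause k ℓ j p ↔
      j = j' ∧ 1 ≤ p' ∧ p' ≤ ℓ j ∧ (b = false ∧ p = p' ∨ b = true ∧ p + 1 = p') := by
  simp only [threadClause, Finset.mem_insert, Finset.mem_singleton,
    eq_comm (a := (Nat.pair (j' + 1) p', b)), compl_node_eq_iff hk, node_eq_iff hk]
  grind

lemma threadClause_inj (hk : 0 < k) {j p j' p' : ℕ} (hℓ : 1 ≤ ℓ j) (hp : p ≤ ℓ j)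
    (h : threadClause k ℓ j p = threadClause k ℓ j' p') : j = j' ∧ p = p' := by
  rcases Nat.eq_zero_or_pos p with rfl | hp0
  · have h₁ : (Nat.pair (j + 1) 1, true) ∈ threadClause k ℓ j 0 :=
      (mem_threadClause_iff hk).2 ⟨rfl, le_rfl, hℓ, by simp⟩
    rw [h, mem_threadClause_iff hk] at h₁
    grind
  · have h₁ : (Nat.pair (j + 1) p, false) ∈ threadClause k ℓ j p :=
      (mem_threadClause_iff hk).2 ⟨rfl, hp0, hp, by simp⟩
    rw [h, mem_threadClause_iff hk] at h₁
    grind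

lemma card_ladder (hk : 0 < k) (hℓ : ∀ j < 3 * k, 1 ≤ ℓ j) :
    (ladder k ℓ).card = ∑ j ∈ Finset.range (3 * k), (ℓ j + 1) := by
  rw [ladder, Finset.card_image_of_injOn, Finset.card_sigma]
  · simp
  · rintro ⟨j, p⟩ h ⟨j', p'⟩ - heq
    simp only [Finset.coe_sigma, Set.mem_sigma_iff, Finset.mem_coe, Finset.mem_range] at h
    obtain ⟨rfl, rfl⟩ := threadClause_inj hk (hℓ j h.1) (Nat.lt_succ_iff.1 h.2) heq
    rfl

lemma mem_varsOf_ladder {v : ℕ} :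
    v ∈ varsOf (ladder k ℓ) ↔ ∃ j p, j < 3 * k ∧ p ≤ ℓ j + 1 ∧ (node k ℓ j p).1 = v := by
  rw [mem_varsOf]
  constructor
  · rintro ⟨C, hC, x, hx, rfl⟩
    obtain ⟨j, p, hj, hp, rfl⟩ := mem_ladder.1 hC
    simp only [threadClause, Finset.mem_insert, Finset.mem_singleton] at hx
    rcases hx with rfl | rfl
    · exact ⟨j, p, hj, by omega, rfl⟩
    · exact ⟨j, p + 1, hj, by omega, rfl⟩
  · rintro ⟨j, p, hj, hp, rfl⟩
    rcases Nat.eq_zero_or_pos p with rfl | hp0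
    · exact ⟨_, threadClause_mem hj (Nat.zero_le _), (node k ℓ j 0).compl,
        by simp [threadClause], rfl⟩
    · obtain ⟨p, rfl⟩ := Nat.exists_eq_succ_of_ne_zero hp0.ne'
      exact ⟨_, threadClause_mem (p := p) hj (by omega), node k ℓ j (p + 1), by simp [threadClause], rfl⟩

lemma varsOf_ladder (hk : 0 < k) :
    varsOf (ladder k ℓ) = ((Finset.range (3 * k + 1)).sigma fun a =>
      if a = 0 then Finset.range (2 * k) else Finset.Icc 1 (ℓ (a - 1))).image
        fun s => Nat.pair s.1 s.2 := by
  ext v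
  simp only [mem_varsOf_ladder, Finset.mem_image, Finset.mem_sigma, Finset.mem_range,
    Sigma.exists]
  constructor
  · rintro ⟨j, p, hj, hp, rfl⟩
    unfold node
    split_ifs with h₁ h₂
    · obtain ⟨m, hm, h⟩ := srcLit_fst hk j
      exact ⟨0, m, ⟨by omega, by simpa using hm⟩, h.symm⟩
    · exact ⟨j + 1, p, ⟨by omega, by simp; omega⟩, rfl⟩
    · obtain ⟨m, hm, h⟩ := tgtLit_fst hk j
      exact ⟨0, m, ⟨by omega, by simpa using hm⟩, h.symm⟩
  · rintro ⟨a, m, ⟨ha, hm⟩, rfl⟩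
    rcases a with _ | j
    · simp only [if_true, Finset.mem_range] at hm
      rcases Nat.even_or_odd' m with ⟨i, rfl | rfl⟩
      · refine ⟨3 * i, 0, by omega, by omega, ?_⟩
        have h₁ : 3 * i % 3 = 0 := by omega
        have h₂ : 3 * i / 3 = i := by omega
        have h₃ : i < k := by omega
        simp [srcLit, h₁, h₂, innLit, h₃]
      · refine ⟨3 * i, ℓ (3 * i) + 1, by omega, le_rfl, ?_⟩
        have h₁ : 3 * i % 3 = 0 := by omega
        have h₂ : 3 * i / 3 = i := by omega
        have h₃ : i < k := by omega
        simp [tgtLit, h₁, h₂, outLit, h₃]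
    · simp at hm
      exact ⟨j, m, by omega, by omega, by rw [node_of_mem hm.1 hm.2]⟩

lemma card_varsOf_ladder (hk : 0 < k) :
    (varsOf (ladder k ℓ)).card = 2 * k + ∑ j ∈ Finset.range (3 * k), ℓ j := by
  rw [varsOf_ladder hk, Finset.card_image_of_injOn, Finset.card_sigma, Finset.sum_range_succ']
  · simp [add_comm]
  · rintro ⟨a, m⟩ - ⟨a', m'⟩ - h
    obtain ⟨rfl, rfl⟩ := Nat.pair_eq_pair.1 h
    rfl

lemma deficiency_ladder (hk : 0 < k) (hℓ : ∀ j < 3 * k, 1 ≤ ℓ j) :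
    deficiency (ladder k ℓ) = k := by
  rw [deficiency, card_ladder hk hℓ, card_varsOf_ladder hk, Finset.sum_add_distrib]
  simp
  ring

lemma isClauseSet_ladder (hk : 0 < k) (hℓ : ∀ j < 3 * k, 1 ≤ ℓ j) :
    IsClauseSet (ladder k ℓ) := by
  intro C hC
  obtain ⟨j, p, hj, hp, rfl⟩ := mem_ladder.1 hC
  have hne : node k ℓ j p ≠ node k ℓ j (p + 1) ∧ node k ℓ j p ≠ (node k ℓ j (p + 1)).compl := by
    have := hℓ j hj
    rcases Nat.eq_zero_or_pos p with rfl | hp0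
    · rw [node_of_mem (j := j) (p := 0 + 1) (by omega) (by omega)]
      exact ⟨srcLit_ne hk _ _ _ _, srcLit_ne hk j j (0 + 1) false⟩
    · rw [node_of_mem (j := j) (p := p) (by omega) (by omega), ne_comm, Ne, node_eq_iff hk,
        ne_comm, Ne, compl_node_eq_iff hk]
      grind
  intro x hx hx'
  simp only [threadClause, Finset.mem_insert, Finset.mem_singleton] at hx hx'
  rcases hx with rfl | rfl
  · rw [Lit.compl_compl] at hx'
    rcases hx' with h | h
    · exact Lit.compl_ne _ h.symm
    · exact hne.1 h
  · rcases hx' with h | h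
    · exact hne.1 (Lit.compl_injective h).symm
    · exact Lit.compl_ne _ h

lemma card_le_two_of_mem_ladder {C : Finset Lit} (hC : C ∈ ladder k ℓ) : C.card ≤ 2 := by
  obtain ⟨j, p, -, -, rfl⟩ := mem_ladder.1 hC
  exact Finset.card_le_two

lemma exists_litVal_threadClause {φ : ℕ → Bool} {j p : ℕ} :
    (∃ x ∈ threadClause k ℓ j p, LitVal φ x = true) ↔
      (LitVal φ (node k ℓ j p) = true → LitVal φ (node k ℓ j (p + 1)) = true) := by
  simp only [threadClause, Finset.mem_insert, Finset.mem_singleton, exists_eq_or_imp,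
    exists_eq_left, litVal_compl]
  cases LitVal φ (node k ℓ j p) <;> simp

lemma litVal_tgtLit {φ : ℕ → Bool} (hφ : ∀ C ∈ ladder k ℓ, ∃ x ∈ C, LitVal φ x = true) {j : ℕ}
    (hj : j < 3 * k) (h : LitVal φ (srcLit k j) = true) : LitVal φ (tgtLit k j) = true := by
  have : ∀ p ≤ ℓ j + 1, LitVal φ (node k ℓ j p) = true := by
    intro p
    induction p with
    | zero => exact fun _ => h
    | succ p ih =>
      intro hp
      exact exists_litVal_threadClause.1 (hφ _ (threadClause_mem hj (by omega))) (ih (by omega))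
  simpa using this _ le_rfl

lemma srcLit_tgtLit (k i : ℕ) :
    srcLit k (3 * i) = innLit k i ∧ tgtLit k (3 * i) = outLit k i ∧
    srcLit k (3 * i + 1) = outLit k i ∧ tgtLit k (3 * i + 1) = innLit k (i + 1) ∧
    srcLit k (3 * i + 2) = outLit k (i + 1) ∧ tgtLit k (3 * i + 2) = innLit k i := by
  have h₁ : (3 * i + 1) / 3 = i := by omega
  have h₂ : (3 * i + 2) / 3 = i := by omega
  simp [srcLit, tgtLit, Nat.add_mod, h₁, h₂]

lemma not_sat_ladder (hk : 0 < k) : ¬ Sat (ladder k ℓ) := by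
  rintro ⟨φ, hφ⟩
  have hAB : ∀ i < k, LitVal φ (innLit k i) = true → LitVal φ (outLit k i) = true := by
    intro i hi
    simpa only [srcLit_tgtLit] using litVal_tgtLit hφ (j := 3 * i) (by omega)
  have hBA : ∀ i < k, LitVal φ (outLit k i) = true → LitVal φ (innLit k (i + 1)) = true := by
    intro i hi
    simpa only [srcLit_tgtLit] using litVal_tgtLit hφ (j := 3 * i + 1) (by omega)
  have hBA' : ∀ i < k, LitVal φ (outLit k (i + 1)) = true → LitVal φ (innLit k i) = true := by
    intro i hi
    simpa only [srcLit_tgtLit] using litVal_tgtLit hφ (j := 3 * i + 2) (by omega)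
  have hA : LitVal φ (innLit k k) = !LitVal φ (outLit k 0) := by rw [innLit_self hk, litVal_compl]
  have hB : LitVal φ (outLit k k) = !LitVal φ (innLit k 0) := by rw [outLit_self hk, litVal_compl]
  have hup : LitVal φ (outLit k 0) = true → ∀ i < k, LitVal φ (outLit k i) = true := by
    intro h i
    induction i with
    | zero => exact fun _ => h
    | succ i ih => exact fun hi => hAB _ hi (hBA _ (by omega) (ih (by omega)))
  have hout : LitVal φ (outLit k 0) = false := by
    by_contra h
    rw [Bool.not_eq_false] at h
    have := hBA (k - 1) (by omega) (hup h (k - 1) (by omega))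
    rw [Nat.sub_add_cancel hk, hA, h] at this
    simp at this
  have hinn : LitVal φ (innLit k 0) = false := by
    by_contra h
    rw [Bool.not_eq_false] at h
    rw [hAB 0 hk h] at hout
    simp at hout
  have hdown : ∀ i < k, LitVal φ (outLit k (k - i)) = true := by
    intro i
    induction i with
    | zero => simp [hB, hinn]
    | succ i ih =>
      intro hi
      refine hAB _ (by omega) (hBA' _ (by omega) ?_)
      rw [show k - (i + 1) + 1 = k - i by omega]
      exact ih (by omega)
  have := hBA' 0 hk (by simpa [show k - (k - 1) = 1 by omega] using hdown (k - 1) (by omega))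
  rw [hinn] at this
  simp at this

lemma sat_erase_threadClause (hk : 0 < k) {j₀ p₀ : ℕ} (hp₀ : p₀ ≤ ℓ j₀) {φ : ℕ → Bool}
    (hφ : ∀ j < 3 * k, j ≠ j₀ → LitVal φ (srcLit k j) = true → LitVal φ (tgtLit k j) = true) :
    Sat ((ladder k ℓ).erase (threadClause k ℓ j₀ p₀)) := by
  set ψ : ℕ → Bool := fun v => if v.unpair.1 = 0 then φ v else
    if v.unpair.1 = j₀ + 1 ∧ p₀ < v.unpair.2 then LitVal φ (tgtLit k (v.unpair.1 - 1))
    else LitVal φ (srcLit k (v.unpair.1 - 1)) with hψ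
  have hsrc : ∀ j, LitVal ψ (srcLit k j) = LitVal φ (srcLit k j) := fun j => by
    obtain ⟨m, -, hm⟩ := srcLit_fst hk j
    exact litVal_congr (by simp [hψ, hm])
  have htgt : ∀ j, LitVal ψ (tgtLit k j) = LitVal φ (tgtLit k j) := fun j => by
    obtain ⟨m, -, hm⟩ := tgtLit_fst hk j
    exact litVal_congr (by simp [hψ, hm])
  have hnode : ∀ j p, p ≤ ℓ j + 1 → LitVal ψ (node k ℓ j p) =
      if (j = j₀ ∧ p₀ < p) ∨ p = ℓ j + 1 then LitVal φ (tgtLit k j)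
      else LitVal φ (srcLit k j) := by
    intro j p hp
    unfold node
    split_ifs with h₁ h₂ h₂ h₃ h₃
    · omega
    · exact hsrc j
    · simp only [LitVal, if_true, hψ, Nat.unpair_pair, Nat.add_eq_zero_iff, one_ne_zero,
        and_false, if_false, Nat.add_right_cancel_iff, Nat.add_sub_cancel]
      rw [if_pos (by omega)]
    · simp only [LitVal, if_true, hψ, Nat.unpair_pair, Nat.add_eq_zero_iff, one_ne_zero,
        and_false, if_false, Nat.add_right_cancel_iff, Nat.add_sub_cancel]
      rw [if_neg (by omega)]
    · exact htgt j
    · omega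
  refine ⟨ψ, fun C hC => ?_⟩
  obtain ⟨hne, hC⟩ := Finset.mem_erase.1 hC
  obtain ⟨j, p, hj, hp, rfl⟩ := mem_ladder.1 hC
  have hjp : ¬ (j = j₀ ∧ p = p₀) := by
    rintro ⟨rfl, rfl⟩
    exact hne rfl
  rw [exists_litVal_threadClause, hnode j p (by omega), hnode j (p + 1) (by omega)]
  have := hφ j hj
  grind

end LowerBoundFamily

section LadderMinimality

lemma exists_litVal_eq {k : ℕ} (A B : ℕ → Bool) (hA : A k = !B 0) (hB : B k = !A 0) :
    ∃ φ : ℕ → Bool, ∀ i ≤ k, LitVal φ (innLit k i) = A i ∧ LitVal φ (outLit k i) = B i := by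
  refine ⟨fun v => if v.unpair.2 % 2 = 0 then A (v.unpair.2 / 2) else B (v.unpair.2 / 2),
    fun i hi => ?_⟩
  rcases hi.lt_or_eq with h | rfl
  · have : (2 * i + 1) / 2 = i := by omega
    simp [innLit, outLit, h, LitVal, this, Nat.add_mod]
  · simp [innLit, outLit, LitVal, hA, hB]

lemma exists_assignment_of_ne {k j₀ : ℕ} (hj₀ : j₀ < 3 * k) : ∃ φ : ℕ → Bool,
    ∀ j < 3 * k, j ≠ j₀ → LitVal φ (srcLit k j) = true → LitVal φ (tgtLit k j) = true := by
  have key : ∃ A B : ℕ → Bool, A k = !B 0 ∧ B k = !A 0 ∧ ∀ i < k,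
      (3 * i ≠ j₀ → A i = true → B i = true) ∧
      (3 * i + 1 ≠ j₀ → B i = true → A (i + 1) = true) ∧
      (3 * i + 2 ≠ j₀ → B (i + 1) = true → A i = true) := by
    obtain ⟨i₀, r, rfl, hr⟩ : ∃ i₀ r, j₀ = 3 * i₀ + r ∧ r < 3 :=
      ⟨j₀ / 3, j₀ % 3, (Nat.div_add_mod _ _).symm, Nat.mod_lt _ (by omega)⟩
    interval_cases r
    · refine ⟨fun i => decide (i₀ ≤ i), fun i => decide (i₀ < i ∧ ¬ (i = k ∧ i₀ = 0)), ?_, ?_, ?_⟩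
      · simp
        omega
      · simp
        omega
      · intro i hi
        simp
        omega
    · refine ⟨fun i => decide (i ≤ i₀), fun i => decide (i ≤ i₀), ?_, ?_, ?_⟩
      · simp
        omega
      · simp
        omega
      · intro i hi
        simp
        omega
    · refine ⟨fun i => decide (i₀ < i), fun i => decide (i₀ < i), ?_, ?_, ?_⟩
      · simp
        omega
      · simp
        omega
      · intro i hi
        simp
        omega
  obtain ⟨A, B, hA, hB, h⟩ := key
  obtain ⟨φ, hφ⟩ := exists_litVal_eq A B hA hB
  refine ⟨φ, fun j hj hne => ?_⟩
  obtain ⟨i, r, rfl, hr⟩ : ∃ i r, j = 3 * i + r ∧ r < 3 :=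
    ⟨j / 3, j % 3, (Nat.div_add_mod _ _).symm, Nat.mod_lt _ (by omega)⟩
  have hi : i < k := by omega
  obtain ⟨h₀, h₁, h₂⟩ := h i hi
  obtain ⟨e₀, e₁, e₂, e₃, e₄, e₅⟩ := srcLit_tgtLit k i
  have hφi := hφ i hi.le
  have hφi' := hφ (i + 1) hi
  interval_cases r
  · rw [add_zero, e₀, e₁, hφi.1, hφi.2]
    exact h₀ (by simpa using hne)
  · rw [e₂, e₃, hφi.2, hφi'.1]
    exact h₁ hne
  · rw [e₄, e₅, hφi'.2, hφi.1]
    exact h₂ hne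

lemma mu2_ladder {k : ℕ} {ℓ : ℕ → ℕ} (hk : 0 < k) (hℓ : ∀ j < 3 * k, 1 ≤ ℓ j) :
    MU2 (ladder k ℓ) := by
  refine ⟨⟨isClauseSet_ladder hk hℓ, not_sat_ladder hk, fun G hG => ?_⟩,
    fun C => card_le_two_of_mem_ladder⟩
  obtain ⟨C, hC, hCG⟩ := Finset.ssubset_iff_exists_subset_erase.1 hG
  obtain ⟨j, p, hj, hp, rfl⟩ := mem_ladder.1 hC
  obtain ⟨φ, hφ⟩ := exists_assignment_of_ne hj
  exact (sat_erase_threadClause hk hp hφ).mono hCG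

end LadderMinimality

section ThreadLengths

/-- Every literal over the variable of `x` is contained in at most one clause. -/
def IsLinear (F : Finset (Finset Lit)) (x : Lit) : Prop :=
  ∀ y, y = x ∨ y = x.compl → ∀ C ∈ F, ∀ D ∈ F, y ∈ C → y ∈ D → C = D

/-- The literals `y 0, …, y (w + 1)` form a maximal path of implications with linear interior
literals. -/
def IsLinearPath (F : Finset (Finset Lit)) (w : ℕ) (y : ℕ → Lit) : Prop :=
  ¬ IsLinear F (y 0) ∧ ¬ IsLinear F (y (w + 1)) ∧ (∀ p, 1 ≤ p → p ≤ w → IsLinear F (y p)) ∧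
    ∀ p ≤ w, ({(y p).compl, y (p + 1)} : Finset Lit) ∈ F

/-- The numbers of interior literals of the maximal paths of implications. -/
def threadLengths (F : Finset (Finset Lit)) : Set ℕ := {w | ∃ y, IsLinearPath F w y}

lemma isLinear_compl {F : Finset (Finset Lit)} {x : Lit} :
    IsLinear F x.compl ↔ IsLinear F x := by
  unfold IsLinear
  simp only [Lit.compl_compl, or_comm]

lemma isLinear_iff_of_cnfIso {F F' : Finset (Finset Lit)} {f : Lit → Lit} (h : CNFIso F F' f)
    {x : Lit} (hx : x ∈ litsOf F) : IsLinear F' (f x) ↔ IsLinear F x := by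
  obtain ⟨hbij, hc, rfl⟩ := h
  have hmem : ∀ C ∈ F, ∀ y ∈ litsOf F, f y ∈ C.image f → y ∈ C := by
    intro C hC y hy hyC
    obtain ⟨z, hz, hzy⟩ := Finset.mem_image.1 hyC
    rwa [← hbij.injOn (mem_litsOf_of_mem hC hz) hy hzy]
  constructor
  · intro h y hy C hC D hD hyC hyD
    have hfy : f y = f x ∨ f y = (f x).compl := by
      rcases hy with rfl | rfl
      · exact Or.inl rfl
      · exact Or.inr (hc x hx)
    have himg := h (f y) hfy _ (Finset.mem_image_of_mem _ hC) _ (Finset.mem_image_of_mem _ hD)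
      (Finset.mem_image_of_mem _ hyC) (Finset.mem_image_of_mem _ hyD)
    ext z
    exact ⟨fun hz => hmem D hD z (mem_litsOf_of_mem hC hz)
        (himg ▸ Finset.mem_image_of_mem f hz),
      fun hz => hmem C hC z (mem_litsOf_of_mem hD hz)
        (himg ▸ Finset.mem_image_of_mem f hz)⟩
  · intro h y hy C' hC' D' hD' hyC hyD
    obtain ⟨C, hC, rfl⟩ := Finset.mem_image.1 hC'
    obtain ⟨D, hD, rfl⟩ := Finset.mem_image.1 hD'
    obtain ⟨z, hz, hzx, rfl⟩ : ∃ z ∈ litsOf F, (z = x ∨ z = x.compl) ∧ y = f z := by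
      rcases hy with rfl | rfl
      · exact ⟨x, hx, Or.inl rfl, rfl⟩
      · exact ⟨x.compl, compl_mem hx, Or.inr rfl, (hc x hx).symm⟩
    rw [h z hzx C hC D hD (hmem C hC z hz hyC) (hmem D hD z hz hyD)]

lemma threadLengths_subset_of_cnfIso {F F' : Finset (Finset Lit)} {f : Lit → Lit}
    (h : CNFIso F F' f) : threadLengths F ⊆ threadLengths F' := by
  rintro w ⟨y, h₀, h₁, h₂, h₃⟩
  have hy : ∀ p ≤ w, y p ∈ litsOf F ∧ y (p + 1) ∈ litsOf F := fun p hp =>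
    ⟨by simpa using compl_mem (mem_litsOf_of_mem (h₃ p hp) (Finset.mem_insert_self _ _)),
      mem_litsOf_of_mem (h₃ p hp) (by simp)⟩
  refine ⟨f ∘ y, ?_, ?_, fun p hp hpw => ?_, fun p hp => ?_⟩
  · rwa [Function.comp_apply, isLinear_iff_of_cnfIso h (hy 0 (Nat.zero_le _)).1]
  · rwa [Function.comp_apply, isLinear_iff_of_cnfIso h (hy w le_rfl).2]
  · exact (isLinear_iff_of_cnfIso h (hy p hpw).1).2 (h₂ p hp hpw)
  · have := Finset.mem_image_of_mem (fun C => C.image f) (h₃ p hp)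
    rw [h.2.2] at this
    simpa [Finset.image_insert, h.2.1 _ (hy p hp).1] using this

lemma threadLengths_eq_of_quot_mk_eq {k : ℤ} {n : ℕ} {F F' : MU2dn k n}
    (h : Quot.mk (@isoRel k n) F = Quot.mk (@isoRel k n) F') :
    threadLengths F.1 = threadLengths F'.1 := by
  refine congrArg (Quot.lift (fun F : MU2dn k n => threadLengths F.1) ?_) h
  rintro F F' ⟨f, hf⟩
  obtain ⟨g, hg⟩ := hf.exists_symm
  exact (threadLengths_subset_of_cnfIso hf).antisymm (threadLengths_subset_of_cnfIso hg)

lemma IsLinearPath.le_of_eq {F : Finset (Finset Lit)} {w w' : ℕ} {y y' : ℕ → Lit}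
    (h : IsLinearPath F w y) (h' : IsLinearPath F w' y') (h₁ : y 1 = y' 1) : w' ≤ w := by
  by_contra! hlt
  have : ∀ p ≤ w, y (p + 1) = y' (p + 1) := by
    intro p
    induction p with
    | zero => exact fun _ => h₁
    | succ p ih =>
      intro hp
      have ih := ih (by omega)
      have heq := h.2.2.1 (p + 1) (by omega) hp (y (p + 1)).compl (Or.inr rfl) _
        (h.2.2.2 (p + 1) hp) _ (h'.2.2.2 (p + 1) (by omega)) (by simp) (by simp [ih])
      rw [ih] at heq
      have m₁ : y (p + 1 + 1) ∈ ({(y' (p + 1)).compl, y' (p + 1 + 1)} : Finset Lit) := by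
        rw [← heq]
        simp
      have m₂ : y' (p + 1 + 1) ∈ ({(y' (p + 1)).compl, y (p + 1 + 1)} : Finset Lit) := by
        rw [heq]
        simp
      simp only [Finset.mem_insert, Finset.mem_singleton] at m₁ m₂
      grind
  refine h.2.1 ?_
  rw [this w le_rfl]
  exact h'.2.2.1 (w + 1) (by omega) hlt

lemma IsLinearPath.eq_of_eq {F : Finset (Finset Lit)} {w w' : ℕ} {y y' : ℕ → Lit}
    (h : IsLinearPath F w y) (h' : IsLinearPath F w' y') (h₁ : y 1 = y' 1) : w = w' :=
  (h'.le_of_eq h h₁.symm).antisymm (h.le_of_eq h' h₁)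

lemma IsLinearPath.reverse {F : Finset (Finset Lit)} {w : ℕ} {y : ℕ → Lit}
    (h : IsLinearPath F w y) : IsLinearPath F w fun p => (y (w + 1 - p)).compl := by
  obtain ⟨h₀, h₁, h₂, h₃⟩ := h
  refine ⟨by simpa [isLinear_compl], by simpa [isLinear_compl], fun p hp hpw => ?_,
    fun p hp => ?_⟩
  · exact isLinear_compl.2 (h₂ _ (by omega) (by omega))
  · have := h₃ (w - p) (by omega)
    rw [show w - p + 1 = w + 1 - p by omega] at this
    change ({(y (w + 1 - p)).compl.compl, (y (w + 1 - (p + 1))).compl} : Finset Lit) ∈ F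
    rw [Lit.compl_compl, Finset.pair_comm, show w + 1 - (p + 1) = w - p by omega]
    exact this

variable {k : ℕ} {ℓ : ℕ → ℕ}

lemma not_isLinear_of_mem (hk : 0 < k) (hℓ : ∀ j < 3 * k, 1 ≤ ℓ j) {x : Lit} {j p j' p' : ℕ}
    (hj : j < 3 * k) (hp : p ≤ ℓ j) (hj' : j' < 3 * k) (hp' : p' ≤ ℓ j')
    (hx : x ∈ threadClause k ℓ j p) (hx' : x ∈ threadClause k ℓ j' p')
    (hne : ¬ (j = j' ∧ p = p')) : ¬ IsLinear (ladder k ℓ) x := fun h =>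
  hne (threadClause_inj hk (hℓ j hj) hp
    (h x (Or.inl rfl) _ (threadClause_mem hj hp) _ (threadClause_mem hj' hp') hx hx'))

lemma compl_srcLit_mem (j : ℕ) : (srcLit k j).compl ∈ threadClause k ℓ j 0 := by
  simp [threadClause]

lemma tgtLit_mem (j : ℕ) : tgtLit k j ∈ threadClause k ℓ j (ℓ j) := by
  simp [threadClause]

lemma not_isLinear_innLit (hk : 0 < k) (hℓ : ∀ j < 3 * k, 1 ≤ ℓ j) {i : ℕ} (hi : i ≤ k) :
    ¬ IsLinear (ladder k ℓ) (innLit k i) := by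
  rcases Nat.eq_zero_or_pos i with rfl | hi0
  · refine not_isLinear_of_mem hk hℓ (j := 2) (p := ℓ 2) (j' := 3 * (k - 1) + 2) (p' := 0)
      (by omega) le_rfl (by omega) (Nat.zero_le _) ?_ ?_ ?_
    · simpa only [srcLit_tgtLit] using tgtLit_mem (k := k) (ℓ := ℓ) (3 * 0 + 2)
    · have := compl_srcLit_mem (k := k) (ℓ := ℓ) (3 * (k - 1) + 2)
      simpa only [srcLit_tgtLit, Nat.sub_add_cancel hk, outLit_self hk, Lit.compl_compl] using this
    · have := hℓ 2 (by omega)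
      omega
  · have h₁ : innLit k i ∈ threadClause k ℓ (3 * (i - 1) + 1) (ℓ (3 * (i - 1) + 1)) := by
      have := tgtLit_mem (k := k) (ℓ := ℓ) (3 * (i - 1) + 1)
      simpa only [srcLit_tgtLit, Nat.sub_add_cancel hi0] using this
    have := hℓ (3 * (i - 1) + 1) (by omega)
    rcases hi.lt_or_eq with hlt | rfl
    · refine not_isLinear_of_mem hk hℓ (j' := 3 * i + 2) (p' := ℓ (3 * i + 2))
        (by omega) le_rfl (by omega) le_rfl h₁ ?_ (by omega)
      simpa only [srcLit_tgtLit] using tgtLit_mem (k := k) (ℓ := ℓ) (3 * i + 2)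
    · refine not_isLinear_of_mem hk hℓ (j' := 1) (p' := 0)
        (by omega) le_rfl (by omega) (Nat.zero_le _) h₁ ?_ (by omega)
      rw [innLit_self hk]
      simpa only [srcLit_tgtLit] using compl_srcLit_mem (k := i) (ℓ := ℓ) (3 * 0 + 1)

lemma not_isLinear_outLit (hk : 0 < k) (hℓ : ∀ j < 3 * k, 1 ≤ ℓ j) {i : ℕ} (hi : i ≤ k) :
    ¬ IsLinear (ladder k ℓ) (outLit k i) := by
  rcases Nat.eq_zero_or_pos i with rfl | hi0
  · rw [← isLinear_compl, ← innLit_self hk]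
    exact not_isLinear_innLit hk hℓ le_rfl
  rcases hi.lt_or_eq with hlt | rfl
  · rw [← isLinear_compl]
    refine not_isLinear_of_mem hk hℓ (j := 3 * i + 1) (p := 0) (j' := 3 * (i - 1) + 2) (p' := 0)
      (by omega) (Nat.zero_le _) (by omega) (Nat.zero_le _) ?_ ?_ (by omega)
    · simpa only [srcLit_tgtLit] using compl_srcLit_mem (k := k) (ℓ := ℓ) (3 * i + 1)
    · have := compl_srcLit_mem (k := k) (ℓ := ℓ) (3 * (i - 1) + 2)
      simpa only [srcLit_tgtLit, Nat.sub_add_cancel hi0] using this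
  · rw [outLit_self hk, isLinear_compl]
    exact not_isLinear_innLit hk hℓ (Nat.zero_le _)

lemma isLinear_of_eq_pair (hk : 0 < k) {j p : ℕ} :
    IsLinear (ladder k ℓ) (Nat.pair (j + 1) p, true) := by
  intro y hy C hC D hD hyC hyD
  obtain ⟨b, rfl⟩ : ∃ b, y = (Nat.pair (j + 1) p, b) := by
    rcases hy with rfl | rfl
    exacts [⟨_, rfl⟩, ⟨_, rfl⟩]
  obtain ⟨j₁, p₁, -, -, rfl⟩ := mem_ladder.1 hC
  obtain ⟨j₂, p₂, -, -, rfl⟩ := mem_ladder.1 hD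
  rw [mem_threadClause_iff hk] at hyC hyD
  obtain ⟨rfl, h₁⟩ := hyC
  obtain ⟨rfl, h₂⟩ := hyD
  obtain rfl : p₁ = p₂ := by grind
  rfl

lemma not_isLinear_srcLit (hk : 0 < k) (hℓ : ∀ j < 3 * k, 1 ≤ ℓ j) {j : ℕ} (hj : j < 3 * k) :
    ¬ IsLinear (ladder k ℓ) (srcLit k j) := by
  unfold srcLit
  split_ifs
  exacts [not_isLinear_innLit hk hℓ (by omega), not_isLinear_outLit hk hℓ (by omega),
    not_isLinear_outLit hk hℓ (by omega)]

lemma not_isLinear_tgtLit (hk : 0 < k) (hℓ : ∀ j < 3 * k, 1 ≤ ℓ j) {j : ℕ} (hj : j < 3 * k) :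
    ¬ IsLinear (ladder k ℓ) (tgtLit k j) := by
  unfold tgtLit
  split_ifs
  exacts [not_isLinear_outLit hk hℓ (by omega), not_isLinear_innLit hk hℓ (by omega),
    not_isLinear_innLit hk hℓ (by omega)]

lemma isLinear_node (hk : 0 < k) {j p : ℕ} (h₁ : 1 ≤ p) (h₂ : p ≤ ℓ j) :
    IsLinear (ladder k ℓ) (node k ℓ j p) := by
  rw [node_of_mem h₁ h₂]
  exact isLinear_of_eq_pair hk

lemma isLinearPath_node (hk : 0 < k) (hℓ : ∀ j < 3 * k, 1 ≤ ℓ j) {j : ℕ} (hj : j < 3 * k) :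
    IsLinearPath (ladder k ℓ) (ℓ j) (node k ℓ j) :=
  ⟨not_isLinear_srcLit hk hℓ hj, by simpa using not_isLinear_tgtLit hk hℓ hj,
    fun _ => isLinear_node hk, fun _ => threadClause_mem hj⟩

lemma threadLengths_ladder (hk : 0 < k) (hℓ : ∀ j < 3 * k, 1 ≤ ℓ j) :
    threadLengths (ladder k ℓ) = {w | ∃ j < 3 * k, ℓ j = w} := by
  ext w
  constructor
  · rintro ⟨y, hy⟩
    obtain ⟨j, p, hj, hp, h⟩ := mem_ladder.1 (hy.2.2.2 0 (Nat.zero_le _))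
    refine ⟨j, hj, ?_⟩
    have hn := isLinearPath_node hk hℓ hj
    have h₀ := hy.1
    have m₁ : (y 0).compl ∈ threadClause k ℓ j p := by simp [h]
    have m₂ : y 1 ∈ threadClause k ℓ j p := by simp [h]
    have m₃ : node k ℓ j (p + 1) ∈ ({(y 0).compl, y 1} : Finset Lit) := by
      rw [zero_add] at h
      simp [← h, threadClause]
    have m₄ : (node k ℓ j p).compl ∈ ({(y 0).compl, y 1} : Finset Lit) := by
      rw [zero_add] at h
      simp [← h, threadClause]
    simp only [threadClause, Finset.mem_insert, Finset.mem_singleton] at m₁ m₂ m₃ m₄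
    have hcases : ((y 0).compl = (node k ℓ j p).compl ∧ y 1 = node k ℓ j (p + 1)) ∨
        ((y 0).compl = node k ℓ j (p + 1) ∧ y 1 = (node k ℓ j p).compl) := by grind
    rcases hcases with ⟨e₀, e₁⟩ | ⟨e₀, e₁⟩
    · rw [Lit.compl_inj] at e₀
      rcases Nat.eq_zero_or_pos p with rfl | hp0
      · exact hn.eq_of_eq hy e₁.symm
      · exact absurd (isLinear_node hk hp0 hp) (e₀ ▸ h₀)
    · rw [← isLinear_compl, e₀] at h₀
      obtain rfl : p = ℓ j := by
        by_contra hne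
        exact h₀ (isLinear_node hk (by omega) (by omega))
      exact hn.reverse.eq_of_eq hy (by simp [e₁])
  · rintro ⟨j, hj, rfl⟩
    exact ⟨_, isLinearPath_node hk hℓ hj⟩

end ThreadLengths

section LowerBound

/-- Thread lengths of a ladder with `n` variables, prescribed except on the last thread. -/
def ladderLengths (k n q : ℕ) (a : Fin (3 * k - 1) → Fin q) (j : ℕ) : ℕ :=
  if h : j < 3 * k - 1 then a ⟨j, h⟩ + 1 else n - 2 * k - ∑ i, ((a i : ℕ) + 1)

variable {k n q : ℕ}

lemma sum_add_one_le (a : Fin (3 * k - 1) → Fin q) :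
    ∑ i, ((a i : ℕ) + 1) ≤ (3 * k - 1) * q := by
  simpa using Finset.sum_le_card_nsmul Finset.univ (fun i => (a i : ℕ) + 1) q
    fun i _ => (a i).isLt

lemma one_le_ladderLengths (h : 2 * k + (3 * k - 1) * q + 1 ≤ n) (a : Fin (3 * k - 1) → Fin q)
    (j : ℕ) : 1 ≤ ladderLengths k n q a j := by
  have := sum_add_one_le a
  unfold ladderLengths
  split_ifs <;> omega

lemma sum_ladderLengths (hk : 0 < k) (h : 2 * k + (3 * k - 1) * q + 1 ≤ n)
    (a : Fin (3 * k - 1) → Fin q) :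
    2 * k + ∑ j ∈ Finset.range (3 * k), ladderLengths k n q a j = n := by
  have h₁ : ∑ j ∈ Finset.range (3 * k - 1), ladderLengths k n q a j =
      ∑ i, ((a i : ℕ) + 1) := by
    rw [Finset.sum_range]
    exact Finset.sum_congr rfl fun i _ => dif_pos i.isLt
  have h₂ : ladderLengths k n q a (3 * k - 1) = n - 2 * k - ∑ i, ((a i : ℕ) + 1) :=
    dif_neg (lt_irrefl _)
  have := sum_add_one_le a
  rw [show 3 * k = 3 * k - 1 + 1 by omega, Finset.sum_range_succ, h₁, h₂]
  omega

lemma pow_le_mul_numClasses (hk : 2 ≤ k) (hq : 0 < q) (h : 2 * k + (3 * k - 1) * q + 1 ≤ n) :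
    q ^ (3 * k - 1) ≤ numClasses (k : ℤ) n * (3 * k) ^ (3 * k) := by
  have hk0 : 0 < k := by omega
  have : NeZero q := ⟨hq.ne'⟩
  have := finite_quot (n := n) hk
  have hℓ := one_le_ladderLengths h
  set G : (Fin (3 * k - 1) → Fin q) → Quot (@isoRel (k : ℤ) n) := fun a =>
    Quot.mk _ ⟨ladder k (ladderLengths k n q a), mu2_ladder hk0 fun j _ => hℓ a j,
      deficiency_ladder hk0 fun j _ => hℓ a j,
      by rw [card_varsOf_ladder hk0, sum_ladderLengths hk0 h]⟩ with hG
  have hπ : ∀ a, ∃ π : Fin (3 * k) → Fin (3 * k), ∀ j : Fin (3 * k), ladderLengths k n q a j =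
      ladderLengths k n q (Function.invFun G (G a)) (π j) := by
    intro a
    have heq := threadLengths_eq_of_quot_mk_eq (Function.invFun_eq (f := G) ⟨a, rfl⟩)
    rw [threadLengths_ladder hk0 fun j _ => hℓ _ j,
      threadLengths_ladder hk0 fun j _ => hℓ _ j] at heq
    have : ∀ j : Fin (3 * k), ∃ i : Fin (3 * k), ladderLengths k n q a j =
        ladderLengths k n q (Function.invFun G (G a)) i := by
      intro j
      obtain ⟨i, hi, hij⟩ := heq.symm.subset ⟨(j : ℕ), j.isLt, rfl⟩
      exact ⟨⟨i, hi⟩, hij.symm⟩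
    choose π hπ using this
    exact ⟨π, hπ⟩
  choose π hπ using hπ
  have hinj : Function.Injective fun a => (G a, π a) := by
    intro a a' haa
    obtain ⟨hGa, hπa⟩ := Prod.mk.inj haa
    ext i
    have e := hπ a ⟨i, by omega⟩
    rw [hGa, hπa, ← hπ a'] at e
    simpa [ladderLengths] using e
  have := Nat.card_le_card_of_injective _ hinj
  simpa [Nat.card_prod, Nat.card_eq_fintype_card, numClasses] using this

end LowerBound

theorem stmt13 (k : ℕ) (hk : 2 ≤ k) :
    ∃ c₁ c₂ : ℝ, 0 < c₁ ∧ 0 < c₂ ∧ ∃ N : ℕ, ∀ n : ℕ, N ≤ n →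
      c₁ * (n : ℝ) ^ (3 * k - 1) ≤ (numClasses (k : ℤ) n : ℝ) ∧
      (numClasses (k : ℤ) n : ℝ) ≤ c₂ * (n : ℝ) ^ (3 * k - 1) := by
  have hk0 : (0 : ℝ) < k := by exact_mod_cast (by omega : 0 < k)
  refine ⟨(1 / (12 * k)) ^ (3 * k - 1) / (3 * k) ^ (3 * k),
    (3 * k + 1) * (2 * k * 2 * (2 * k * 2) + 1) ^ (3 * k) * 2 ^ (3 * k - 1),
    by positivity, by positivity, 6 * k, fun n hn => ⟨?_, ?_⟩⟩
  · have hq : 0 < n / (6 * k) := Nat.div_pos hn (by omega)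
    have hq' : (3 * k) * (n / (6 * k)) + (3 * k) * (n / (6 * k)) ≤ n := by
      have := Nat.div_mul_le_self n (6 * k)
      nlinarith
    have hqn : n ≤ 12 * k * (n / (6 * k)) := by
      have := Nat.lt_mul_div_succ n (show 0 < 6 * k by omega)
      nlinarith
    have hle : (3 * k - 1) * (n / (6 * k)) ≤ (3 * k) * (n / (6 * k)) :=
      Nat.mul_le_mul_right _ (by omega)
    have hmain : ((n / (6 * k) : ℕ) : ℝ) ^ (3 * k - 1) ≤
        numClasses (k : ℤ) n * (3 * k) ^ (3 * k) := by
      exact_mod_cast pow_le_mul_numClasses (n := n) hk hq (by omega)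
    rw [div_mul_eq_mul_div, div_le_iff₀ (by positivity), ← mul_pow]
    refine le_trans (pow_le_pow_left₀ (by positivity) ?_ _) hmain
    rw [one_div_mul_eq_div, div_le_iff₀' (by positivity)]
    exact_mod_cast hqn
  · have h : (numClasses (k : ℤ) n : ℝ) ≤
        (3 * k + 1) * ((2 * k * 2 * (2 * k * 2) + 1) ^ (3 * k) * (n + 1) ^ (3 * k - 1)) := by
      exact_mod_cast numClasses_le (n := n) hk
    refine h.trans ?_
    rw [← mul_assoc, mul_assoc _ ((2 : ℝ) ^ (3 * k - 1)), ← mul_pow]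
    refine mul_le_mul_of_nonneg_left (pow_le_pow_left₀ (by positivity) ?_ _) (by positivity)
    have : (1 : ℝ) ≤ n := by exact_mod_cast (by omega : 1 ≤ n)
    linarith
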